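/- arXiv:1008.1151 — 3 statements merged into one kernel-verified Lean document; each statement's English description precedes it below -/
import Mathlib

section
/- Let 𝒜 ⊆ B(H) be a concrete C*-algebra acting on a complex separable Hilbert space H. Then 𝒜 admits a Følner net if and only if 𝒜 admits a hypertrace, i.e. a state Ψ on B(H) satisfying Ψ(X A) = Ψ(A X) for all X ∈ B(H) and all A ∈ 𝒜. -/
open Filter
open scoped ComplexOrder

universe u

noncomputable def hsNorm {H : Type*} [NormedAddCommGroup H] [InnerProductSpace ℂ H]
    {ι : Type*} (e : HilbertBasis ι ℂ H) (A : H →L[ℂ] H) : ℝ :=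
  Real.sqrt (∑' i, ‖A (e i)‖ ^ 2)

/-- `P` is a non-zero finite-rank orthogonal projection. -/
def IsFiniteRankProjection {H : Type*} [NormedAddCommGroup H] [InnerProductSpace ℂ H]
    [CompleteSpace H] (P : H →L[ℂ] H) : Prop :=
  IsSelfAdjoint P ∧ P * P = P ∧ P ≠ 0 ∧ FiniteDimensional ℂ (LinearMap.range (P : H →ₗ[ℂ] H))

open scoped InnerProductSpace
open InnerProductSpace (rankOne)

section HilbertSchmidt

variable {H : Type*} [NormedAddCommGroup H] [InnerProductSpace ℂ H]
  {ι κ : Type*} [Fintype κ]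

theorem hsNorm_nonneg (e : HilbertBasis ι ℂ H) (T : H →L[ℂ] H) : 0 ≤ hsNorm e T :=
  Real.sqrt_nonneg _

theorem hsNorm_smul (e : HilbertBasis ι ℂ H) (c : ℂ) (T : H →L[ℂ] H) :
    hsNorm e (c • T) = ‖c‖ * hsNorm e T := by
  simp only [hsNorm, smul_apply, norm_smul, mul_pow, tsum_mul_left]
  rw [Real.sqrt_mul (sq_nonneg _), Real.sqrt_sq (norm_nonneg c)]

/-- The squared Hilbert–Schmidt norm of the finite-rank operator `∑ k, ⟪b k, ·⟫ • y k`. -/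
theorem hsNorm_sq_of_eq_sum (e : HilbertBasis ι ℂ H) (T : H →L[ℂ] H) (b y : κ → H)
    (hT : ∀ x, T x = ∑ k, ⟪b k, x⟫_ℂ • y k) :
    hsNorm e T ^ 2 = (∑ k, ∑ l, ⟪b l, b k⟫_ℂ * ⟪y k, y l⟫_ℂ).re := by
  have hsum : HasSum (fun i => ‖T (e i)‖ ^ 2) (∑ k, ∑ l, ⟪b l, b k⟫_ℂ * ⟪y k, y l⟫_ℂ).re := by
    have h : HasSum (fun i => ∑ k, ∑ l, (⟪b l, e i⟫_ℂ * ⟪e i, b k⟫_ℂ) * ⟪y k, y l⟫_ℂ)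
        (∑ k, ∑ l, ⟪b l, b k⟫_ℂ * ⟪y k, y l⟫_ℂ) :=
      hasSum_sum fun k _ => hasSum_sum fun l _ =>
        (e.hasSum_inner_mul_inner (b l) (b k)).mul_right _
    have h2 := Complex.hasSum_re h
    convert! h2 using 2 with i
    rw [← inner_self_eq_norm_sq (𝕜 := ℂ), hT, sum_inner]
    simp only [inner_sum, inner_smul_left, inner_smul_right, inner_conj_symm, RCLike.re_to_complex]
    congr 1
    refine Finset.sum_congr rfl fun k _ => Finset.sum_congr rfl fun l _ => ?_
    ring
  rw [hsNorm, Real.sq_sqrt (tsum_nonneg fun _ => sq_nonneg _), hsum.tsum_eq]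

/-- The orthogonal projection onto the span of a finite orthonormal family. -/
noncomputable def frameProjection (v : κ → H) : H →L[ℂ] H := ∑ k, rankOne ℂ (v k) (v k)

theorem frameProjection_apply (v : κ → H) (x : H) :
    frameProjection v x = ∑ k, ⟪v k, x⟫_ℂ • v k := by
  simp [frameProjection]

theorem hsNorm_frameProjection_sq (e : HilbertBasis ι ℂ H) {v : κ → H} (hv : Orthonormal ℂ v) :
    hsNorm e (frameProjection v) ^ 2 = Fintype.card κ := by
  classical
  rw [hsNorm_sq_of_eq_sum e _ v v (frameProjection_apply v)]
  simp [orthonormal_iff_ite.1 hv]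

theorem norm_sub_frameProjection_sq {v : κ → H} (hv : Orthonormal ℂ v) (x : H) :
    ‖x - frameProjection v x‖ ^ 2 = ‖x‖ ^ 2 - ∑ k, ‖⟪v k, x⟫_ℂ‖ ^ 2 := by
  have h1 : ⟪x, frameProjection v x⟫_ℂ = ((∑ k, ‖⟪v k, x⟫_ℂ‖ ^ 2 : ℝ) : ℂ) := by
    rw [frameProjection_apply, inner_sum]
    push_cast
    refine Finset.sum_congr rfl fun k _ => ?_
    rw [inner_smul_right, ← inner_conj_symm x, Complex.mul_conj']
  have h2 : ‖frameProjection v x‖ ^ 2 = ∑ k, ‖⟪v k, x⟫_ℂ‖ ^ 2 := by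
    rw [← inner_self_eq_norm_sq (𝕜 := ℂ), frameProjection_apply, hv.inner_sum]
    simp only [Complex.conj_mul', RCLike.re_to_complex]
    exact_mod_cast rfl
  rw [@norm_sub_sq ℂ, h1, h2]
  simp only [RCLike.re_to_complex, Complex.ofReal_re]
  ring

/-- The normalized trace of the compression to the span of `v`. -/
noncomputable def frameState (v : κ → H) (X : H →L[ℂ] H) : ℂ :=
  (Fintype.card κ : ℂ)⁻¹ * ∑ k, ⟪v k, X (v k)⟫_ℂ

theorem norm_frameState_le {v : κ → H} (hv : Orthonormal ℂ v) (X : H →L[ℂ] H) :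
    ‖frameState v X‖ ≤ ‖X‖ := by
  have h : ‖∑ k, ⟪v k, X (v k)⟫_ℂ‖ ≤ ∑ _k : κ, ‖X‖ :=
    norm_sum_le_of_le _ fun k _ => (norm_inner_le_norm _ _).trans (by
      simpa [hv.norm_eq_one] using X.le_opNorm (v k))
  rw [frameState, norm_mul, norm_inv, Complex.norm_natCast]
  rw [Finset.sum_const, Finset.card_univ, nsmul_eq_mul] at h
  calc (Fintype.card κ : ℝ)⁻¹ * ‖∑ k, ⟪v k, X (v k)⟫_ℂ‖
      ≤ (Fintype.card κ : ℝ)⁻¹ * (Fintype.card κ * ‖X‖) := by gcongr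
    _ = ((Fintype.card κ : ℝ)⁻¹ * Fintype.card κ) * ‖X‖ := by ring
    _ ≤ 1 * ‖X‖ := by gcongr; exact inv_mul_le_one
    _ = ‖X‖ := one_mul _

variable [CompleteSpace H]

theorem adjoint_frameProjection (v : κ → H) : star (frameProjection v) = frameProjection v := by
  simp [frameProjection, ContinuousLinearMap.star_eq_adjoint, star_sum]

/-- The Hilbert–Schmidt norm of the commutator with a finite-rank projection measures the parts of
`A v k` and `star A (v k)` outside of the range. -/
theorem hsNorm_commutator_sq (e : HilbertBasis ι ℂ H) {v : κ → H} (hv : Orthonormal ℂ v)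
    (A : H →L[ℂ] H) :
    hsNorm e (A * frameProjection v - frameProjection v * A) ^ 2 =
      ∑ k, ‖A (v k)‖ ^ 2 + ∑ k, ‖star A (v k)‖ ^ 2 - 2 * ∑ k, ∑ l, ‖⟪v l, A (v k)⟫_ℂ‖ ^ 2 := by
  classical
  rw [hsNorm_sq_of_eq_sum e _ (Sum.elim v fun k => star A (v k))
    (Sum.elim (fun k => A (v k)) fun k => - v k)]
  · have e1 : ∀ k l, ⟪star A (v l), v k⟫_ℂ * ⟪A (v k), v l⟫_ℂ = ‖⟪v l, A (v k)⟫_ℂ‖ ^ 2 := by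
      intro k l
      rw [ContinuousLinearMap.star_eq_adjoint, ContinuousLinearMap.adjoint_inner_left,
        ← inner_conj_symm (A (v k)), Complex.mul_conj']
    have e2 : ∀ k l, ⟪v l, star A (v k)⟫_ℂ * ⟪v k, A (v l)⟫_ℂ = ‖⟪v k, A (v l)⟫_ℂ‖ ^ 2 := by
      intro k l
      rw [ContinuousLinearMap.star_eq_adjoint, ContinuousLinearMap.adjoint_inner_right,
        ← inner_conj_symm (A (v l)), Complex.conj_mul']
    have e3 : ∀ x : H, ⟪x, x⟫_ℂ = ((‖x‖ ^ 2 : ℝ) : ℂ) := fun x => by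
      simp [inner_self_eq_norm_sq_to_K]
    simp only [Fintype.sum_sum_type, Sum.elim_inl, Sum.elim_inr, inner_neg_left, inner_neg_right,
      mul_neg, e1, e2, orthonormal_iff_ite.1 hv, ite_mul, mul_ite, one_mul, mul_one,
      zero_mul, mul_zero, Finset.sum_ite_eq, Finset.sum_ite_eq', Finset.mem_univ, if_true,
      Finset.sum_add_distrib, Finset.sum_neg_distrib, e3]
    rw [Finset.sum_comm (f := fun k l => ((‖⟪v k, A (v l)⟫_ℂ‖ : ℂ)) ^ 2)]
    norm_cast
    ring
  · intro x
    simp [frameProjection_apply, map_sum, Fintype.sum_sum_type, sub_eq_add_neg,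
      ContinuousLinearMap.star_eq_adjoint, ContinuousLinearMap.adjoint_inner_left]

end HilbertSchmidt

section FolnerToHypertrace

variable {H : Type*} [NormedAddCommGroup H] [InnerProductSpace ℂ H] [CompleteSpace H]
  {ι κ : Type*} [Fintype κ]

theorem isFiniteRankProjection_frameProjection [Nonempty κ] {v : κ → H} (hv : Orthonormal ℂ v) :
    IsFiniteRankProjection (frameProjection v) := by
  classical
  have hfix : ∀ k, frameProjection v (v k) = v k := fun k => by
    simp [frameProjection_apply, orthonormal_iff_ite.1 hv]
  refine ⟨adjoint_frameProjection v, ?_, ?_, ?_⟩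
  · ext x
    rw [mul_apply_eq_comp, frameProjection_apply v x]
    simp [map_sum, hfix]
  · intro h
    obtain ⟨k⟩ := ‹Nonempty κ›
    have := hfix k
    rw [h] at this
    exact hv.ne_zero k this.symm
  · have := FiniteDimensional.span_of_finite ℂ (Set.finite_range v)
    refine Submodule.finiteDimensional_of_le (S₂ := Submodule.span ℂ (Set.range v)) ?_
    rintro _ ⟨x, rfl⟩
    rw [ContinuousLinearMap.coe_coe, frameProjection_apply]
    exact Submodule.sum_mem _ fun k _ =>
      Submodule.smul_mem _ _ (Submodule.subset_span (Set.mem_range_self k))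

theorem IsFiniteRankProjection.exists_eq_frameProjection {P : H →L[ℂ] H}
    (hP : IsFiniteRankProjection P) :
    ∃ (n : ℕ) (v : Fin n → H), 0 < n ∧ Orthonormal ℂ v ∧ P = frameProjection v := by
  obtain ⟨hsa, hidem, hne, hfin⟩ := hP
  let b := stdOrthonormalBasis ℂ (LinearMap.range (P : H →ₗ[ℂ] H))
  have hfix : ∀ k, P (b k) = b k := by
    intro k
    obtain ⟨x, hx⟩ := (b k).2
    rw [← hx, ContinuousLinearMap.coe_coe, ← mul_apply_eq_comp, hidem]
  have hP : P = frameProjection fun k => (b k : H) := by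
    ext x
    have h := congrArg Subtype.val (b.sum_repr' ⟨P x, x, rfl⟩)
    rw [frameProjection_apply]
    simp only [Submodule.coe_sum, Submodule.coe_smul, Submodule.coe_inner] at h
    rw [← h]
    refine Finset.sum_congr rfl fun k _ => ?_
    have hsym := (ContinuousLinearMap.isSelfAdjoint_iff_isSymmetric.1 hsa) (b k : H) x
    simp only [ContinuousLinearMap.coe_coe] at hsym
    rw [← hsym, hfix]
  refine ⟨_, fun k => (b k : H), ?_, ?_, hP⟩
  · rw [Nat.pos_iff_ne_zero]
    intro h0
    refine hne ?_
    rw [hP]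
    have : IsEmpty (Fin (Module.finrank ℂ (LinearMap.range (P : H →ₗ[ℂ] H)))) := by
      rw [h0]; infer_instance
    simp [frameProjection]
  · exact b.orthonormal.comp_linearIsometry (Submodule.subtypeₗᵢ _)

/-- The failure of `X ↦ ∑ k, ⟪v k, X (v k)⟫` to be tracial against `A` is controlled by the
Hilbert–Schmidt norm of the commutator of `A` with the projection. -/
theorem norm_sum_inner_commutator_le (e : HilbertBasis ι ℂ H) {v : κ → H} (hv : Orthonormal ℂ v)
    (A X : H →L[ℂ] H) :
    ‖∑ k, ⟪v k, (X * A - A * X) (v k)⟫_ℂ‖ ≤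
      2 * ‖X‖ * (√(Fintype.card κ) *
        hsNorm e (A * frameProjection v - frameProjection v * A)) := by
  set P := frameProjection v with hP
  set y : κ → H := fun k => A (v k) - P (A (v k)) with hy
  set z : κ → H := fun k => star A (v k) - P (star A (v k)) with hz
  have hnorm : ∑ k, ‖y k‖ ^ 2 + ∑ k, ‖z k‖ ^ 2 = hsNorm e (A * P - P * A) ^ 2 := by
    rw [hsNorm_commutator_sq e hv]
    simp only [hy, hz, hP, norm_sub_frameProjection_sq hv, Finset.sum_sub_distrib]
    have : ∑ k, ∑ l, ‖⟪v l, star A (v k)⟫_ℂ‖ ^ 2 = ∑ k, ∑ l, ‖⟪v l, A (v k)⟫_ℂ‖ ^ 2 := by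
      rw [Finset.sum_comm]
      refine Finset.sum_congr rfl fun k _ => Finset.sum_congr rfl fun l _ => ?_
      rw [ContinuousLinearMap.star_eq_adjoint, ContinuousLinearMap.adjoint_inner_right,
        norm_inner_symm]
    rw [this]
    ring
  have hsum : ∀ w : κ → H, ∑ k, ‖w k‖ ^ 2 ≤ hsNorm e (A * P - P * A) ^ 2 →
      ∑ k, ‖w k‖ ≤ √(Fintype.card κ) * hsNorm e (A * P - P * A) := by
    intro w hw
    refine le_of_sq_le_sq ?_ (mul_nonneg (Real.sqrt_nonneg _) (hsNorm_nonneg _ _))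
    rw [mul_pow, Real.sq_sqrt (Nat.cast_nonneg _)]
    refine (sq_sum_le_card_mul_sum_sq (s := Finset.univ)).trans ?_
    rw [Finset.card_univ]
    gcongr
  have hcancel : ∑ k, ⟪v k, X (P (A (v k)))⟫_ℂ = ∑ k, ⟪P (star A (v k)), X (v k)⟫_ℂ := by
    simp only [hP, frameProjection_apply, map_sum, map_smul, inner_sum, sum_inner,
      inner_smul_left, inner_smul_right, inner_conj_symm]
    rw [Finset.sum_comm]
    refine Finset.sum_congr rfl fun k _ => Finset.sum_congr rfl fun l _ => ?_
    rw [ContinuousLinearMap.star_eq_adjoint, ContinuousLinearMap.adjoint_inner_left]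
  have hsplit : ∑ k, ⟪v k, (X * A - A * X) (v k)⟫_ℂ =
      ∑ k, ⟪v k, X (y k)⟫_ℂ - ∑ k, ⟪z k, X (v k)⟫_ℂ := by
    simp only [hy, hz, map_sub, inner_sub_right, inner_sub_left, Finset.sum_sub_distrib, hcancel,
      ContinuousLinearMap.star_eq_adjoint, ContinuousLinearMap.adjoint_inner_left,
      sub_apply, mul_apply_eq_comp]
    ring
  have hb1 : ‖∑ k, ⟪v k, X (y k)⟫_ℂ‖ ≤ ‖X‖ * ∑ k, ‖y k‖ := by
    rw [Finset.mul_sum]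
    refine norm_sum_le_of_le _ fun k _ => (norm_inner_le_norm _ _).trans ?_
    rw [hv.norm_eq_one, one_mul]
    exact X.le_opNorm _
  have hb2 : ‖∑ k, ⟪z k, X (v k)⟫_ℂ‖ ≤ ‖X‖ * ∑ k, ‖z k‖ := by
    rw [Finset.mul_sum]
    refine norm_sum_le_of_le _ fun k _ => (norm_inner_le_norm _ _).trans ?_
    rw [mul_comm]
    gcongr
    simpa [hv.norm_eq_one] using X.le_opNorm (v k)
  have h1 := hsum y (by rw [← hnorm]; exact le_add_of_nonneg_right (by positivity))
  have h2 := hsum z (by rw [← hnorm]; exact le_add_of_nonneg_left (by positivity))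
  rw [hsplit]
  refine (norm_sub_le _ _).trans ?_
  nlinarith [mul_le_mul_of_nonneg_left h1 (norm_nonneg X),
    mul_le_mul_of_nonneg_left h2 (norm_nonneg X)]

theorem norm_frameState_commutator_le [Nonempty κ] (e : HilbertBasis ι ℂ H) {v : κ → H}
    (hv : Orthonormal ℂ v) (A X : H →L[ℂ] H) :
    ‖frameState v (X * A - A * X)‖ ≤ 2 * ‖X‖ *
      (hsNorm e (A * frameProjection v - frameProjection v * A) /
        hsNorm e (frameProjection v)) := by
  have hn : (0 : ℝ) < Fintype.card κ := by exact_mod_cast Fintype.card_pos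
  have hP : hsNorm e (frameProjection v) = √(Fintype.card κ) := by
    rw [← hsNorm_frameProjection_sq e hv, Real.sqrt_sq (hsNorm_nonneg _ _)]
  rw [frameState, norm_mul, norm_inv, Complex.norm_natCast, hP, inv_mul_le_iff₀ hn]
  refine (norm_sum_inner_commutator_le e hv A X).trans (le_of_eq ?_)
  have hs := Real.sq_sqrt hn.le
  have hs0 : √(Fintype.card κ : ℝ) ≠ 0 := (Real.sqrt_pos.2 hn).ne'
  field_simp
  rw [hs]
  ring

theorem exists_hypertrace_of_folner (e : HilbertBasis ι ℂ H) (S : Set (H →L[ℂ] H))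
    {I : Type*} (l : Filter I) [l.NeBot] (P : I → H →L[ℂ] H)
    (hP : ∀ i, IsFiniteRankProjection (P i))
    (hS : ∀ A ∈ S, Tendsto (fun i => hsNorm e (A * P i - P i * A) / hsNorm e (P i)) l (nhds 0)) :
    ∃ Ψ : (H →L[ℂ] H) →ₗ[ℂ] ℂ, (∀ X : H →L[ℂ] H, 0 ≤ Ψ (star X * X)) ∧ Ψ 1 = 1 ∧
      ∀ X : H →L[ℂ] H, ∀ A ∈ S, Ψ (X * A) = Ψ (A * X) := by
  choose n v hn hv hPv using fun i => (hP i).exists_eq_frameProjection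
  have hne : ∀ i, Nonempty (Fin (n i)) := fun i => ⟨⟨0, hn i⟩⟩
  let U := Ultrafilter.of l
  have hlim : ∀ X : H →L[ℂ] H, ∃ c, Tendsto (fun i => frameState (v i) X) U (nhds c) := by
    intro X
    obtain ⟨c, -, hc⟩ := (isCompact_closedBall (0 : ℂ) ‖X‖).ultrafilter_le_nhds
      (U.map fun i => frameState (v i) X) (tendsto_principal.2 (Eventually.of_forall fun i => by
        simpa using norm_frameState_le (hv i) X))
    exact ⟨c, hc⟩
  choose Ψ hΨ using hlim
  let Ψ' : (H →L[ℂ] H) →ₗ[ℂ] ℂ :=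
    { toFun := Ψ
      map_add' := fun X Y => tendsto_nhds_unique (hΨ (X + Y)) (by
        refine ((hΨ X).add (hΨ Y)).congr fun i => ?_
        simp [frameState, Finset.sum_add_distrib, mul_add])
      map_smul' := fun c X => tendsto_nhds_unique (hΨ (c • X)) (by
        refine ((hΨ X).const_mul c).congr fun i => ?_
        simp only [frameState, smul_apply, inner_smul_right, ← Finset.mul_sum]
        ring) }
  refine ⟨Ψ', fun X => ?_, ?_, fun X A hA => ?_⟩
  · refine ge_of_tendsto' (hΨ (star X * X)) fun i => ?_
    rw [frameState]
    refine mul_nonneg (by positivity) (Finset.sum_nonneg fun k _ => ?_)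
    rw [ContinuousLinearMap.star_eq_adjoint, mul_apply_eq_comp,
      ContinuousLinearMap.adjoint_inner_right]
    rw [inner_self_eq_norm_sq_to_K]
    positivity
  · refine tendsto_nhds_unique (hΨ 1) (tendsto_const_nhds.congr fun i => ?_)
    have : (n i : ℂ) ≠ 0 := by exact_mod_cast (hn i).ne'
    simp [frameState, inner_self_eq_norm_sq_to_K, (hv i).norm_eq_one, this]
  · rw [← sub_eq_zero, ← map_sub]
    refine tendsto_nhds_unique (hΨ _) (squeeze_zero_norm (fun i => ?_)
      (by simpa using ((hS A hA).mono_left (Ultrafilter.of_le l)).const_mul (2 * ‖X‖)))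
    simpa only [hPv] using norm_frameState_commutator_le e (hv i) A X

end FolnerToHypertrace

section Diagonalization

variable {H : Type*} [NormedAddCommGroup H] [InnerProductSpace ℂ H] {κ : Type*} [Fintype κ]

/-- Spectral theorem for the finite-rank self-adjoint operator `∑ k, c k • ⟪y k, ·⟫ • y k`. -/
theorem exists_orthonormal_diagonalization (c : κ → ℝ) (y : κ → H) :
    ∃ (n : ℕ) (z : Fin n → H) (d : Fin n → ℝ), Orthonormal ℂ z ∧
      (∀ l, ∑ k, ((c k : ℂ) * ⟪y k, z l⟫_ℂ) • y k = (d l : ℂ) • z l) ∧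
      ∀ k, ∑ l, ⟪z l, y k⟫_ℂ • z l = y k := by
  let K := Submodule.span ℂ (Set.range y)
  have : FiniteDimensional ℂ K := FiniteDimensional.span_of_finite ℂ (Set.finite_range y)
  let y' : κ → K := fun k => ⟨y k, Submodule.subset_span (Set.mem_range_self k)⟩
  let T : K →ₗ[ℂ] K := (∑ k, (c k : ℂ) • rankOne ℂ (y' k) (y' k) : K →L[ℂ] K)
  have hTapp : ∀ x, T x = ∑ k, ((c k : ℂ) * ⟪y' k, x⟫_ℂ) • y' k := fun x => by
    simp only [T, ContinuousLinearMap.coe_coe, sum_apply, smul_apply,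
      InnerProductSpace.rankOne_apply, smul_smul]
  have hT : T.IsSymmetric := by
    intro a b
    simp only [hTapp, sum_inner, inner_sum, inner_smul_left, inner_smul_right, map_mul,
      Complex.conj_ofReal, inner_conj_symm]
    refine Finset.sum_congr rfl fun k _ => ?_
    ring
  let b := hT.eigenvectorBasis rfl
  refine ⟨_, fun l => (b l : H), hT.eigenvalues rfl,
    b.orthonormal.comp_linearIsometry (Submodule.subtypeₗᵢ _), fun l => ?_, fun k => ?_⟩
  · have h := hT.apply_eigenvectorBasis rfl l
    rw [hTapp] at h
    simpa using congrArg Subtype.val h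
  · simpa using congrArg Subtype.val (b.sum_repr' (y' k))

/-- Every positive combination of vector functionals is a positive combination of vector functionals
of an orthonormal family. -/
theorem exists_orthonormal_sum_inner_eq {c : κ → ℝ} (hc : ∀ k, 0 ≤ c k) (y : κ → H) :
    ∃ (n : ℕ) (v : Fin n → H) (μ : Fin n → ℝ), Orthonormal ℂ v ∧ (∀ l, 0 ≤ μ l) ∧
      ∀ X : H →L[ℂ] H,
        ∑ l, (μ l : ℂ) * ⟪v l, X (v l)⟫_ℂ = ∑ k, (c k : ℂ) * ⟪y k, X (y k)⟫_ℂ := by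
  obtain ⟨n, z, d, hz, hd, hy⟩ := exists_orthonormal_diagonalization c y
  refine ⟨n, z, d, hz, fun l => ?_, fun X => ?_⟩
  · have h : (d l : ℂ) = ((∑ k, c k * ‖⟪y k, z l⟫_ℂ‖ ^ 2 : ℝ) : ℂ) := by
      have h1 := congrArg (fun x => ⟪z l, x⟫_ℂ) (hd l)
      simp only [inner_sum, inner_smul_right, inner_self_eq_norm_sq_to_K, hz.norm_eq_one] at h1
      simp only [RCLike.ofReal_one, one_pow, mul_one] at h1
      rw [← h1]
      push_cast
      refine Finset.sum_congr rfl fun k _ => ?_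
      rw [mul_assoc, ← inner_conj_symm (z l), Complex.mul_conj']
    rw [Complex.ofReal_inj.1 h]
    exact Finset.sum_nonneg fun k _ => mul_nonneg (hc k) (sq_nonneg _)
  · have h1 : ∀ l, (d l : ℂ) * ⟪z l, X (z l)⟫_ℂ =
        ∑ k, (c k : ℂ) * ⟪z l, y k⟫_ℂ * ⟪y k, X (z l)⟫_ℂ := by
      intro l
      have := congrArg (fun x => ⟪x, X (z l)⟫_ℂ) (hd l)
      simpa [sum_inner, inner_smul_left, mul_comm, mul_left_comm] using this.symm
    have h2 : ∀ k, (c k : ℂ) * ⟪y k, X (y k)⟫_ℂ =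
        ∑ l, (c k : ℂ) * ⟪z l, y k⟫_ℂ * ⟪y k, X (z l)⟫_ℂ := by
      intro k
      conv_lhs => rw [← congrArg X (hy k)]
      simp [map_sum, Finset.mul_sum, mul_assoc]
    simp only [h1, h2]
    exact Finset.sum_comm

end Diagonalization

section Separation

variable {H : Type*} [NormedAddCommGroup H] [InnerProductSpace ℂ H]

/-- The functional `X ↦ ⟪y, X x⟫` on the bounded operators. -/
noncomputable def vectorFunctional (y x : H) : StrongDual ℂ (H →L[ℂ] H) :=
  (innerSL ℂ y).comp (ContinuousLinearMap.apply ℂ H x)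

@[simp]
theorem vectorFunctional_apply (y x : H) (X : H →L[ℂ] H) :
    vectorFunctional y x X = ⟪y, X x⟫_ℂ := rfl

theorem norm_vectorFunctional_le (y x : H) : ‖vectorFunctional y x‖ ≤ ‖y‖ * ‖x‖ := by
  refine ContinuousLinearMap.opNorm_le_bound _ (by positivity) fun X => ?_
  rw [vectorFunctional_apply]
  refine (norm_inner_le_norm _ _).trans ?_
  calc ‖y‖ * ‖X x‖ ≤ ‖y‖ * (‖X‖ * ‖x‖) := by gcongr; exact X.le_opNorm x
    _ = _ := by ring

variable [CompleteSpace H]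

/-- A bounded functional on the dual of `B(H)` restricts to a bounded operator on the vector
functionals. -/
theorem exists_operator_inner_eq (f : StrongDual ℂ (H →L[ℂ] H) →L[ℂ] ℂ) :
    ∃ Y : H →L[ℂ] H, ∀ y x, ⟪y, Y x⟫_ℂ = f (vectorFunctional y x) := by
  let B : H →ₗ⋆[ℂ] H →ₗ[ℂ] ℂ := LinearMap.mk₂'ₛₗ (starRingEnd ℂ) (RingHom.id ℂ)
    (fun y x => f (vectorFunctional y x))
    (fun y y' x => by
      rw [← map_add]; congr 1; ext X; simp)
    (fun a y x => by
      rw [← map_smul]; congr 1; ext X; simp [mul_comm])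
    (fun y x x' => by
      rw [← map_add]; congr 1; ext X; simp)
    (fun a y x => by
      rw [RingHom.id_apply, ← map_smul]; congr 1; ext X; simp)
  let B' : H →L⋆[ℂ] H →L[ℂ] ℂ := B.mkContinuous₂ ‖f‖ fun y x => by
    refine (f.le_opNorm _).trans ?_
    rw [mul_assoc]
    gcongr
    exact norm_vectorFunctional_le y x
  refine ⟨(InnerProductSpace.continuousLinearMapOfBilin B').adjoint, fun y x => ?_⟩
  rw [ContinuousLinearMap.adjoint_inner_right, InnerProductSpace.continuousLinearMapOfBilin_apply]
  rfl

theorem le_re_of_le_re_inner {Ψ : (H →L[ℂ] H) →ₗ[ℂ] ℂ}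
    (hpos : ∀ X : H →L[ℂ] H, 0 ≤ Ψ (star X * X)) (hone : Ψ 1 = 1) {T : H →L[ℂ] H}
    {c : ℝ} (hT : ∀ x, ‖x‖ = 1 → c ≤ (⟪x, T x⟫_ℂ).re) :
    2 * c ≤ (Ψ (T + star T)).re := by
  have hT' : ∀ x, c * ‖x‖ ^ 2 ≤ (⟪x, T x⟫_ℂ).re := by
    intro x
    rcases eq_or_ne x 0 with rfl | hx
    · simp
    have hx' : ‖x‖ ≠ 0 := norm_ne_zero_iff.2 hx
    have h := hT ((‖x‖⁻¹ : ℂ) • x) (by simp [norm_smul, hx'])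
    rw [map_smul, inner_smul_left, inner_smul_right, map_inv₀, Complex.conj_ofReal,
      ← Complex.ofReal_inv, Complex.re_ofReal_mul, Complex.re_ofReal_mul] at h
    rw [← mul_assoc, ← mul_inv, inv_mul_eq_div, le_div_iff₀ (by positivity)] at h
    linarith [h, pow_two ‖x‖]
  have hP : 0 ≤ T + star T - ((2 * c : ℝ) : ℂ) • 1 := by
    rw [ContinuousLinearMap.nonneg_iff_isPositive, ContinuousLinearMap.isPositive_def]
    have hsa : IsSelfAdjoint (T + star T - ((2 * c : ℝ) : ℂ) • 1) := by
      refine (IsSelfAdjoint.add_star_self T).sub ?_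
      simp [IsSelfAdjoint, star_smul]
    refine ⟨ContinuousLinearMap.isSelfAdjoint_iff_isSymmetric.1 hsa, fun x => ?_⟩
    have h1 : (⟪x, star T x⟫_ℂ).re = (⟪x, T x⟫_ℂ).re := by
      rw [ContinuousLinearMap.star_eq_adjoint, ContinuousLinearMap.adjoint_inner_right,
        ← inner_conj_symm, Complex.conj_re]
    rw [ContinuousLinearMap.reApplyInnerSelf_apply, inner_re_symm]
    simp only [sub_apply, add_apply, smul_apply, one_apply_eq_self, inner_sub_right,
      inner_add_right, inner_smul_right, RCLike.re_to_complex, Complex.sub_re, Complex.add_re,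
      Complex.re_ofReal_mul, h1]
    have h2 : (⟪x, x⟫_ℂ).re = ‖x‖ ^ 2 := inner_self_eq_norm_sq (𝕜 := ℂ) x
    rw [h2]
    linarith [hT' x]
  obtain ⟨R, hR⟩ := CStarAlgebra.nonneg_iff_eq_star_mul_self.1 hP
  have h := hpos R
  rw [← hR, map_sub, map_smul, hone, smul_eq_mul, mul_one, Complex.le_def] at h
  have := h.1
  rw [Complex.sub_re, Complex.ofReal_re, Complex.zero_re] at this
  linarith

/-- The functional `X ↦ ⟪x, (X * A - A * X) x⟫`. -/
noncomputable def commutatorFunctional (A : H →L[ℂ] H) (x : H) : StrongDual ℂ (H →L[ℂ] H) :=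
  vectorFunctional x (A x) - vectorFunctional (star A x) x

theorem commutatorFunctional_apply (A : H →L[ℂ] H) (x : H) (X : H →L[ℂ] H) :
    commutatorFunctional A x X = ⟪x, (X * A - A * X) x⟫_ℂ := by
  simp [commutatorFunctional, ContinuousLinearMap.star_eq_adjoint,
    ContinuousLinearMap.adjoint_inner_left]

/-- A hypertrace is approximated in trace norm by finite-rank density operators. -/
theorem exists_approximate_density {Ψ : (H →L[ℂ] H) →ₗ[ℂ] ℂ}
    (hpos : ∀ X : H →L[ℂ] H, 0 ≤ Ψ (star X * X)) (hone : Ψ 1 = 1)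
    {κ : Type*} [Fintype κ] (A : κ → H →L[ℂ] H)
    (hA : ∀ k X, Ψ (X * A k) = Ψ (A k * X)) (hA' : ∀ k X, Ψ (X * star (A k)) = Ψ (star (A k) * X))
    {ε : ℝ} (hε : 0 < ε) :
    ∃ (n : ℕ) (v : Fin n → H) (μ : Fin n → ℝ), Orthonormal ℂ v ∧ (∀ l, 0 ≤ μ l) ∧ ∑ l, μ l = 1 ∧
      ∀ k X, ‖∑ l, (μ l : ℂ) * ⟪v l, (X * A k - A k * X) (v l)⟫_ℂ‖ ≤ ε * ‖X‖ := by
  classical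
  let S : Set (κ → StrongDual ℂ (H →L[ℂ] H)) :=
    (fun x k => commutatorFunctional (A k) x) '' Metric.sphere (0 : H) 1
  have hnd : ¬ Disjoint (Metric.ball (0 : κ → StrongDual ℂ (H →L[ℂ] H)) ε) (convexHull ℝ S) := by
    intro hdisj
    have : IsScalarTower ℝ ℂ (StrongDual ℂ (H →L[ℂ] H)) := inferInstance
    have : IsScalarTower ℝ ℂ (κ → StrongDual ℂ (H →L[ℂ] H)) := Pi.isScalarTower
    obtain ⟨f, c, hball, hS⟩ := RCLike.geometric_hahn_banach_open (𝕜 := ℂ) (convex_ball _ _)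
      Metric.isOpen_ball (convex_convexHull ℝ S) hdisj
    have hc : 0 < c := by simpa using hball 0 (Metric.mem_ball_self hε)
    choose Y hY using fun k => exists_operator_inner_eq
      (f.comp (ContinuousLinearMap.single ℂ (fun _ : κ => StrongDual ℂ (H →L[ℂ] H)) k))
    let T := ∑ k, (Y k * A k - A k * Y k)
    have hT : ∀ x, ‖x‖ = 1 → c ≤ (⟪x, T x⟫_ℂ).re := by
      intro x hx
      have h := hS _ (subset_convexHull ℝ S ⟨x, by simpa using hx, rfl⟩)
      have hf : f (fun k => commutatorFunctional (A k) x) = ⟪x, T x⟫_ℂ := by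
        rw [← Finset.univ_sum_single (fun k => commutatorFunctional (A k) x), map_sum]
        simp only [T, sum_apply, inner_sum]
        refine Finset.sum_congr rfl fun k _ => ?_
        rw [← commutatorFunctional_apply]
        have := hY k
        simp only [ContinuousLinearMap.comp_apply, ContinuousLinearMap.single_apply] at this
        rw [commutatorFunctional, Pi.single_sub, map_sub, ← this, ← this]
        rfl
      rwa [hf] at h
    have h0 : Ψ (T + star T) = 0 := by
      simp only [T, star_sum, star_sub, star_mul, map_add, map_sum, map_sub, hA, hA', sub_self,
        Finset.sum_const_zero, add_zero]
    have := le_re_of_le_re_inner hpos hone hT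
    rw [h0, Complex.zero_re] at this
    linarith
  obtain ⟨g, hgball, hgS⟩ := Set.not_disjoint_iff.1 hnd
  obtain ⟨J, _, w, s, hw, hw1, hs, hsum⟩ := mem_convexHull_iff_exists_fintype.1 hgS
  choose x hx hxs using hs
  obtain ⟨n, v, μ, hv, hμ, hvx⟩ := exists_orthonormal_sum_inner_eq hw x
  have hx1 : ∀ j, ‖x j‖ = 1 := fun j => by simpa using hx j
  refine ⟨n, v, μ, hv, hμ, ?_, fun k X => ?_⟩
  · have h := hvx 1
    simp only [one_apply_eq_self, inner_self_eq_norm_sq_to_K, hv.norm_eq_one, hx1,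
      RCLike.ofReal_one, one_pow, mul_one] at h
    rw [← hw1]
    exact_mod_cast h
  · have hg : g k X = ∑ l, (μ l : ℂ) * ⟪v l, (X * A k - A k * X) (v l)⟫_ℂ := by
      rw [hvx, ← hsum]
      simp only [Finset.sum_apply, Pi.smul_apply, sum_apply, smul_apply, ← hxs,
        commutatorFunctional_apply, Complex.real_smul]
    rw [← hg]
    refine ((g k).le_opNorm X).trans ?_
    gcongr
    exact (norm_le_pi_norm g k).trans (mem_ball_zero_iff.1 hgball).le

end Separation

section PowersStormer

variable {H : Type*} [NormedAddCommGroup H] [InnerProductSpace ℂ H]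

theorem norm_sum_rankOne_self_le {n : ℕ} {z : Fin n → H} (hz : Orthonormal ℂ z) {s : Fin n → ℝ}
    (hs : ∀ l, |s l| ≤ 1) : ‖∑ l, (s l : ℂ) • rankOne ℂ (z l) (z l)‖ ≤ 1 := by
  refine ContinuousLinearMap.opNorm_le_bound _ zero_le_one fun x => ?_
  rw [one_mul]
  refine le_of_sq_le_sq ?_ (norm_nonneg x)
  refine le_trans ?_ (hz.sum_inner_products_le x (s := Finset.univ))
  rw [← inner_self_eq_norm_sq (𝕜 := ℂ)]
  simp only [sum_apply, smul_apply, InnerProductSpace.rankOne_apply, smul_smul]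
  rw [hz.inner_sum, map_sum]
  refine Finset.sum_le_sum fun l _ => ?_
  rw [Complex.conj_mul', RCLike.re_to_complex, ← Complex.ofReal_pow, Complex.ofReal_re, norm_mul,
    mul_pow, Complex.norm_real, Real.norm_eq_abs]
  exact mul_le_of_le_one_left (sq_nonneg _) (pow_le_one₀ (abs_nonneg _) (hs l))

variable [CompleteSpace H] {κ : Type*}

theorem orthonormal_unitary_comp {v : κ → H} (hv : Orthonormal ℂ v)
    {U : H →L[ℂ] H} (hU : U ∈ unitary (H →L[ℂ] H)) : Orthonormal ℂ fun k => U (v k) := by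
  classical
  rw [orthonormal_iff_ite] at hv ⊢
  intro i j
  rw [← hv i j, ← ContinuousLinearMap.adjoint_inner_right, ← ContinuousLinearMap.star_eq_adjoint,
    ← mul_apply_eq_comp, (Unitary.mem_iff.1 hU).1, one_apply_eq_self]

variable [Fintype κ]

/-- A form of the Powers–Størmer inequality: if `ρ = ∑ i, μ i • ⟪v i, ·⟫ • v i` almost commutes in
trace norm with the unitary `U`, then so does its square root in the Hilbert–Schmidt norm. -/
theorem two_sub_two_mul_overlap_le {v : κ → H} (hv : Orthonormal ℂ v) {μ : κ → ℝ}
    (hμ : ∀ i, 0 ≤ μ i) (hμ1 : ∑ i, μ i = 1) {U : H →L[ℂ] H} (hU : U ∈ unitary (H →L[ℂ] H))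
    {ε : ℝ} (hε : ∀ X : H →L[ℂ] H,
      ‖∑ i, (μ i : ℂ) * ⟪v i, (X * U - U * X) (v i)⟫_ℂ‖ ≤ ε * ‖X‖) (hε0 : 0 ≤ ε) :
    2 - 2 * ∑ i, ∑ j, √(μ i) * √(μ j) * ‖⟪v i, U (v j)⟫_ℂ‖ ^ 2 ≤ ε := by
  have hUU : U * star U = 1 := (Unitary.mem_iff.1 hU).2
  let w : κ → H := fun i => U (v i)
  have hw : Orthonormal ℂ w := orthonormal_unitary_comp hv hU
  obtain ⟨n, z, d, hz, hd, hy⟩ := exists_orthonormal_diagonalization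
    (Sum.elim (fun i => √(μ i)) fun i => -√(μ i)) (Sum.elim v w)
  have hvz : ∀ i, ∑ l, ⟪z l, v i⟫_ℂ • z l = v i := fun i => hy (Sum.inl i)
  have hwz : ∀ i, ∑ l, ⟪z l, w i⟫_ℂ • z l = w i := fun i => hy (Sum.inr i)
  let R : (κ → H) → Fin n → H := fun x l => ∑ i, ((√(μ i) : ℂ) * ⟪x i, z l⟫_ℂ) • x i
  have hRd : ∀ l, R v l - R w l = (d l : ℂ) • z l := by
    intro l
    rw [← hd l, Fintype.sum_sum_type]
    simp [R, sub_eq_add_neg]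
  have hRsq : ∀ x : κ → H, Orthonormal ℂ x → ∀ l,
      ‖R x l‖ ^ 2 = ∑ i, μ i * ‖⟪z l, x i⟫_ℂ‖ ^ 2 := by
    intro x hx l
    rw [← inner_self_eq_norm_sq (𝕜 := ℂ), hx.inner_sum, map_sum]
    refine Finset.sum_congr rfl fun i _ => ?_
    rw [Complex.conj_mul', RCLike.re_to_complex, ← Complex.ofReal_pow, Complex.ofReal_re, norm_mul,
      mul_pow, Complex.norm_real, Real.norm_eq_abs, sq_abs, Real.sq_sqrt (hμ i), norm_inner_symm]
  have hRin : ∀ (x : κ → H) l, (⟪z l, R x l⟫_ℂ).re = ∑ i, √(μ i) * ‖⟪z l, x i⟫_ℂ‖ ^ 2 := by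
    intro x l
    rw [inner_sum, Complex.re_sum]
    refine Finset.sum_congr rfl fun i _ => ?_
    rw [inner_smul_right, mul_assoc, Complex.re_ofReal_mul, ← inner_conj_symm (x i),
      Complex.conj_mul', ← Complex.ofReal_pow, Complex.ofReal_re]
  have hRin0 : ∀ (x : κ → H) l, 0 ≤ (⟪z l, R x l⟫_ℂ).re := fun x l => by
    rw [hRin]
    positivity
  have hdiff : ∀ l, (⟪z l, R v l⟫_ℂ).re - (⟪z l, R w l⟫_ℂ).re = d l := by
    intro l
    rw [← Complex.sub_re, ← inner_sub_right, hRd, inner_smul_right, inner_self_eq_norm_sq_to_K,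
      hz.norm_eq_one]
    simp
  have hsqdiff : ∀ l, ‖R v l‖ ^ 2 - ‖R w l‖ ^ 2 =
      d l * ((⟪z l, R v l⟫_ℂ).re + (⟪z l, R w l⟫_ℂ).re) := by
    intro l
    have h : R v l = (d l : ℂ) • z l + R w l := by rw [← hRd, sub_add_cancel]
    have h1 : ‖R v l‖ ^ 2 = d l ^ 2 + 2 * (d l * (⟪z l, R w l⟫_ℂ).re) + ‖R w l‖ ^ 2 := by
      rw [h, @norm_add_sq ℂ, inner_smul_left, norm_smul, hz.norm_eq_one, Complex.conj_ofReal]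
      simp
    rw [h1, ← hdiff l]
    ring
  -- testing against the sign of the difference of the square roots
  let s : Fin n → ℝ := fun l => SignType.sign (d l)
  let X : H →L[ℂ] H := ∑ l, (s l : ℂ) • rankOne ℂ (z l) (z l)
  have hs : ∀ l, |s l| ≤ 1 := fun l => by
    rcases lt_trichotomy (d l) 0 with h | h | h <;> simp [s, h]
  have hX : ∀ x : H, ⟪x, X x⟫_ℂ = ((∑ l, s l * ‖⟪z l, x⟫_ℂ‖ ^ 2 : ℝ) : ℂ) := by
    intro x
    simp only [X, sum_apply, smul_apply, InnerProductSpace.rankOne_apply, inner_sum,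
      inner_smul_right]
    push_cast
    refine Finset.sum_congr rfl fun l _ => ?_
    rw [← inner_conj_symm x, Complex.mul_conj']
  have hXsum : ∀ x : κ → H, Orthonormal ℂ x →
      ∑ i, (μ i : ℂ) * ⟪x i, X (x i)⟫_ℂ = ((∑ l, s l * ‖R x l‖ ^ 2 : ℝ) : ℂ) := by
    intro x hx
    simp only [hX, hRsq x hx, Finset.mul_sum]
    push_cast
    simp only [Finset.mul_sum]
    rw [Finset.sum_comm]
    refine Finset.sum_congr rfl fun l _ => Finset.sum_congr rfl fun i _ => ?_
    ring
  have hsum_le : ∑ l, (s l * ‖R v l‖ ^ 2 - s l * ‖R w l‖ ^ 2) ≤ ε := by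
    have h1 : ∑ i, (μ i : ℂ) * ⟪v i, ((star U * X) * U - U * (star U * X)) (v i)⟫_ℂ =
        ((∑ l, s l * ‖R w l‖ ^ 2 - ∑ l, s l * ‖R v l‖ ^ 2 : ℝ) : ℂ) := by
      rw [Complex.ofReal_sub, ← hXsum v hv, ← hXsum w hw, ← Finset.sum_sub_distrib]
      refine Finset.sum_congr rfl fun i _ => ?_
      rw [← mul_assoc U, hUU, one_mul, sub_apply, inner_sub_right, mul_sub]
      congr 2
      rw [mul_apply_eq_comp, mul_apply_eq_comp, ContinuousLinearMap.star_eq_adjoint,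
        ContinuousLinearMap.adjoint_inner_right]
    have h2 := hε (star U * X)
    have h3 : ‖star U * X‖ ≤ 1 := by
      rw [CStarRing.norm_mem_unitary_mul X (Unitary.star_mem hU)]
      exact norm_sum_rankOne_self_le hz hs
    rw [h1, Complex.norm_real, Real.norm_eq_abs] at h2
    rw [Finset.sum_sub_distrib]
    have h4 := neg_abs_le (∑ l, s l * ‖R w l‖ ^ 2 - ∑ l, s l * ‖R v l‖ ^ 2)
    have h5 : ε * ‖star U * X‖ ≤ ε * 1 := by gcongr
    linarith
  have hd_le : ∑ l, d l ^ 2 ≤ ε := by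
    refine le_trans (Finset.sum_le_sum fun l _ => ?_) hsum_le
    rw [← mul_sub, hsqdiff, ← mul_assoc, mul_comm (s l), self_mul_sign, ← sq_abs, pow_two]
    gcongr
    rw [← hdiff l, abs_le]
    constructor <;> linarith [hRin0 v l, hRin0 w l]
  -- expanding the Hilbert–Schmidt norm of the difference of the square roots
  have hone : ∀ x : κ → H, Orthonormal ℂ x → (∀ i, ∑ l, ⟪z l, x i⟫_ℂ • z l = x i) →
      ∑ l, ‖R x l‖ ^ 2 = 1 := by
    intro x hx hxz
    simp only [hRsq x hx]
    rw [Finset.sum_comm, ← hμ1]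
    refine Finset.sum_congr rfl fun i _ => ?_
    rw [← Finset.mul_sum]
    convert! mul_one (μ i)
    have h : ‖x i‖ ^ 2 = 1 := by rw [hx.norm_eq_one, one_pow]
    rw [← inner_self_eq_norm_sq (𝕜 := ℂ), ← hxz i, hz.inner_sum, map_sum] at h
    rw [← h]
    refine Finset.sum_congr rfl fun l _ => ?_
    rw [Complex.conj_mul', RCLike.re_to_complex, ← Complex.ofReal_pow, Complex.ofReal_re]
  have hcross : ∑ l, ⟪R v l, R w l⟫_ℂ =
      ((∑ i, ∑ j, √(μ i) * √(μ j) * ‖⟪v i, w j⟫_ℂ‖ ^ 2 : ℝ) : ℂ) := by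
    have hpars : ∀ i j, ∑ l, ⟪z l, v i⟫_ℂ * ⟪w j, z l⟫_ℂ = ⟪w j, v i⟫_ℂ := by
      intro i j
      conv_rhs => rw [← hvz i]
      rw [inner_sum]
      exact Finset.sum_congr rfl fun l _ => (inner_smul_right _ _ _).symm
    simp only [R, sum_inner, inner_sum, inner_smul_left, inner_smul_right, map_mul,
      Complex.conj_ofReal, inner_conj_symm, Finset.mul_sum]
    push_cast
    rw [Finset.sum_comm]
    conv_rhs => rw [Finset.sum_comm]
    refine Finset.sum_congr rfl fun j _ => ?_
    rw [Finset.sum_comm]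
    refine Finset.sum_congr rfl fun i _ => ?_
    rw [← Complex.conj_mul', inner_conj_symm, ← hpars i j, Finset.sum_mul, Finset.mul_sum]
    refine Finset.sum_congr rfl fun l _ => ?_
    ring
  have hexp : ∑ l, d l ^ 2 =
      2 - 2 * ∑ i, ∑ j, √(μ i) * √(μ j) * ‖⟪v i, w j⟫_ℂ‖ ^ 2 := by
    have h : ∀ l, d l ^ 2 = ‖R v l‖ ^ 2 - 2 * (⟪R v l, R w l⟫_ℂ).re + ‖R w l‖ ^ 2 := by
      intro l
      have := @norm_sub_sq ℂ _ _ _ _ (R v l) (R w l)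
      rw [hRd, norm_smul, hz.norm_eq_one, mul_one, Complex.norm_real, Real.norm_eq_abs,
        sq_abs] at this
      exact this
    simp only [h, Finset.sum_add_distrib, Finset.sum_sub_distrib, ← Finset.mul_sum, hone v hv hvz,
      hone w hw hwz, ← Complex.re_sum, hcross, Complex.ofReal_re]
    ring
  rw [← hexp]
  exact hd_le

theorem one_sub_sum_min_le {μ : κ → ℝ} (hμ : ∀ i, 0 ≤ μ i) (hμ1 : ∑ i, μ i = 1)
    {c : κ → κ → ℝ} (hc : ∀ i j, 0 ≤ c i j) (hrow : ∀ i, ∑ j, c i j ≤ 1)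
    (hcol : ∀ j, ∑ i, c i j ≤ 1) {δ : ℝ} (hδ : 0 < δ)
    (h : 2 - 2 * ∑ i, ∑ j, √(μ i) * √(μ j) * c i j ≤ δ ^ 2) :
    1 - ∑ i, ∑ j, min (μ i) (μ j) * c i j ≤ δ ^ 2 / 2 + δ := by
  have hrow' : ∑ i, ∑ j, μ i * c i j ≤ 1 := by
    rw [← hμ1]
    refine Finset.sum_le_sum fun i _ => ?_
    rw [← Finset.mul_sum]
    exact mul_le_of_le_one_right (hμ i) (hrow i)
  have hcol' : ∑ i, ∑ j, μ j * c i j ≤ 1 := by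
    rw [Finset.sum_comm, ← hμ1]
    refine Finset.sum_le_sum fun j _ => ?_
    rw [← Finset.mul_sum]
    exact mul_le_of_le_one_right (hμ j) (hcol j)
  have hpt : ∀ i j, √(μ i) * √(μ j) - min (μ i) (μ j) ≤
      δ / 2 * μ i + (μ i + μ j - 2 * (√(μ i) * √(μ j))) / (2 * δ) := by
    intro i j
    have hi := Real.sq_sqrt (hμ i)
    have hj := Real.sq_sqrt (hμ j)
    have hi0 := Real.sqrt_nonneg (μ i)
    have hj0 := Real.sqrt_nonneg (μ j)
    generalize √(μ i) = a at *
    generalize √(μ j) = b at *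
    rw [← hi, ← hj]
    have key : δ / 2 * a ^ 2 + (a ^ 2 + b ^ 2 - 2 * (a * b)) / (2 * δ) =
        (δ ^ 2 * a ^ 2 + (a - b) ^ 2) / (2 * δ) := by
      field_simp
      ring
    rw [key, le_div_iff₀ (by positivity)]
    rcases le_total a b with hab | hab
    · rw [min_eq_left (pow_le_pow_left₀ hi0 hab 2)]
      nlinarith [sq_nonneg (δ * a - (b - a))]
    · rw [min_eq_right (pow_le_pow_left₀ hj0 hab 2)]
      have : δ ^ 2 * b ^ 2 ≤ δ ^ 2 * a ^ 2 := by gcongr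
      nlinarith [sq_nonneg (δ * b - (a - b))]
  have hsum : ∑ i, ∑ j, √(μ i) * √(μ j) * c i j - ∑ i, ∑ j, min (μ i) (μ j) * c i j ≤
      δ / 2 * ∑ i, ∑ j, μ i * c i j + (∑ i, ∑ j, μ i * c i j + ∑ i, ∑ j, μ j * c i j -
        2 * ∑ i, ∑ j, √(μ i) * √(μ j) * c i j) / (2 * δ) := by
    simp only [Finset.mul_sum, ← Finset.sum_sub_distrib, ← Finset.sum_add_distrib,
      Finset.sum_div]
    refine Finset.sum_le_sum fun i _ => Finset.sum_le_sum fun j _ => ?_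
    have := mul_le_mul_of_nonneg_right (hpt i j) (hc i j)
    refine le_trans (le_of_eq (by ring)) (this.trans (le_of_eq (by ring)))
  have h1 : δ / 2 * ∑ i, ∑ j, μ i * c i j ≤ δ / 2 := mul_le_of_le_one_right (by positivity) hrow'
  have h2 : (∑ i, ∑ j, μ i * c i j + ∑ i, ∑ j, μ j * c i j -
      2 * ∑ i, ∑ j, √(μ i) * √(μ j) * c i j) / (2 * δ) ≤ δ / 2 := by
    rw [div_le_iff₀ (by positivity)]
    nlinarith
  linarith

theorem integral_ite_lt {a : ℝ} (ha0 : 0 ≤ a) (ha1 : a ≤ 1) :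
    IntervalIntegrable (fun t => if t < a then (1 : ℝ) else 0) MeasureTheory.volume 0 1 ∧
      ∫ t in (0 : ℝ)..1, (if t < a then (1 : ℝ) else 0) = a := by
  have e : (fun t => if t < a then (1 : ℝ) else 0) = (Set.Iio a).indicator 1 := by
    ext t
    simp [Set.indicator]
  rw [e]
  constructor
  · rw [intervalIntegrable_iff]
    refine MeasureTheory.IntegrableOn.indicator ?_ measurableSet_Iio
    exact MeasureTheory.integrableOn_const (C := (1 : ℝ)) (by simp)
  · rw [intervalIntegral.integral_of_le zero_le_one,
      MeasureTheory.integral_indicator_one measurableSet_Iio,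
      MeasureTheory.measureReal_restrict_apply measurableSet_Iio]
    have : (Set.Iio a ∩ Set.Ioc 0 1 : Set ℝ) = Set.Ioo 0 a := by
      ext t
      simp only [Set.mem_inter_iff, Set.mem_Iio, Set.mem_Ioc, Set.mem_Ioo]
      constructor
      · rintro ⟨h1, h2, -⟩
        exact ⟨h2, h1⟩
      · rintro ⟨h1, h2⟩
        exact ⟨h2, h1, h2.le.trans ha1⟩
    rw [this]
    simp [ha0]

/-- Layer-cake principle: a negative weighted sum has a negative superlevel sum. -/
theorem exists_sum_ite_lt_neg {R : Type*} [Fintype R] {a β : R → ℝ} (ha0 : ∀ r, 0 ≤ a r)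
    (ha1 : ∀ r, a r ≤ 1) (h : ∑ r, β r * a r < 0) :
    ∃ t : ℝ, ∑ r, β r * (if t < a r then 1 else 0) < 0 := by
  by_contra! hcon
  have hint : ∫ t in (0 : ℝ)..1, ∑ r, β r * (if t < a r then (1 : ℝ) else 0) =
      ∑ r, β r * a r := by
    rw [intervalIntegral.integral_finsetSum fun r _ =>
      (integral_ite_lt (ha0 r) (ha1 r)).1.const_mul (β r)]
    refine Finset.sum_congr rfl fun r _ => ?_
    rw [intervalIntegral.integral_const_mul, (integral_ite_lt (ha0 r) (ha1 r)).2]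
  exact absurd (hint ▸ intervalIntegral.integral_nonneg zero_le_one fun t _ => hcon t) h.not_ge

end PowersStormer

section HypertraceToFolner

variable {H : Type*} [NormedAddCommGroup H] [InnerProductSpace ℂ H] [CompleteSpace H] {ι : Type*}

theorem hsNorm_commutator_sq_eq_sum_residual {κ : Type*} [Fintype κ] (e : HilbertBasis ι ℂ H)
    {v : κ → H} (hv : Orthonormal ℂ v) (A : H →L[ℂ] H) :
    hsNorm e (A * frameProjection v - frameProjection v * A) ^ 2 =
      ∑ k, ‖A (v k) - frameProjection v (A (v k))‖ ^ 2 +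
        ∑ k, ‖star A (v k) - frameProjection v (star A (v k))‖ ^ 2 := by
  have h : ∑ k, ∑ l, ‖⟪v l, star A (v k)⟫_ℂ‖ ^ 2 = ∑ k, ∑ l, ‖⟪v l, A (v k)⟫_ℂ‖ ^ 2 := by
    rw [Finset.sum_comm]
    refine Finset.sum_congr rfl fun k _ => Finset.sum_congr rfl fun l _ => ?_
    rw [ContinuousLinearMap.star_eq_adjoint, ContinuousLinearMap.adjoint_inner_right,
      norm_inner_symm]
  simp only [norm_sub_frameProjection_sq hv, Finset.sum_sub_distrib]
  rw [hsNorm_commutator_sq e hv, h]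
  ring

theorem hsNorm_commutator_add_sq_le (e : HilbertBasis ι ℂ H) {P : H →L[ℂ] H}
    (hP : IsFiniteRankProjection P) (A B : H →L[ℂ] H) :
    hsNorm e ((A + B) * P - P * (A + B)) ^ 2 ≤
      2 * (hsNorm e (A * P - P * A) ^ 2 + hsNorm e (B * P - P * B) ^ 2) := by
  have key : ∀ Q : H →L[ℂ] H, ∀ x y : H, ‖x + y - Q (x + y)‖ ^ 2 ≤
      2 * (‖x - Q x‖ ^ 2 + ‖y - Q y‖ ^ 2) := by
    intro Q x y
    rw [map_add, add_sub_add_comm]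
    exact (pow_le_pow_left₀ (norm_nonneg _) (norm_add_le _ _) 2).trans (add_sq_le)
  obtain ⟨n, v, -, hv, rfl⟩ := hP.exists_eq_frameProjection
  simp only [hsNorm_commutator_sq_eq_sum_residual e hv, star_add, add_apply]
  simp only [← Finset.sum_add_distrib, Finset.mul_sum]
  refine Finset.sum_le_sum fun k _ => ?_
  linarith [key (frameProjection v) (A (v k)) (B (v k)),
    key (frameProjection v) (star A (v k)) (star B (v k))]

/-- The operators along which a family of projections is asymptotically central form a subspace. -/
def folnerSubmodule (e : HilbertBasis ι ℂ H) {I : Type*} (l : Filter I) (P : I → H →L[ℂ] H)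
    (hP : ∀ i, IsFiniteRankProjection (P i)) : Submodule ℂ (H →L[ℂ] H) where
  carrier := {A | Tendsto (fun i => hsNorm e (A * P i - P i * A) / hsNorm e (P i)) l (nhds 0)}
  zero_mem' := by simpa [hsNorm] using tendsto_const_nhds
  smul_mem' c A hA := by
    have := Tendsto.const_mul ‖c‖ hA
    simpa only [Set.mem_ofPred_eq, smul_mul_assoc, mul_smul_comm, ← smul_sub, hsNorm_smul,
      mul_div_assoc, mul_zero] using this
  add_mem' {A B} hA hB := by
    have h := (((hA.pow 2).add (hB.pow 2)).const_mul 2).sqrt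
    simp only [ne_eq, OfNat.ofNat_ne_zero, not_false_eq_true, zero_pow, add_zero, mul_zero,
      Real.sqrt_zero] at h
    refine squeeze_zero (fun i => div_nonneg (hsNorm_nonneg _ _) (hsNorm_nonneg _ _))
      (fun i => Real.le_sqrt_of_sq_le ?_) h
    rw [div_pow, div_pow, div_pow, ← add_div, ← mul_div_assoc]
    exact div_le_div_of_nonneg_right (hsNorm_commutator_add_sq_le e (hP i) A B) (sq_nonneg _)

theorem exists_projection_almost_commuting (e : HilbertBasis ι ℂ H)
    {Ψ : (H →L[ℂ] H) →ₗ[ℂ] ℂ} (hpos : ∀ X : H →L[ℂ] H, 0 ≤ Ψ (star X * X)) (hone : Ψ 1 = 1)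
    {κ : Type*} [Fintype κ] (U : κ → H →L[ℂ] H) (hU : ∀ k, U k ∈ unitary (H →L[ℂ] H))
    (hΨ : ∀ k X, Ψ (X * U k) = Ψ (U k * X))
    (hΨ' : ∀ k X, Ψ (X * star (U k)) = Ψ (star (U k) * X)) {η : ℝ} (hη : 0 < η) :
    ∃ P : H →L[ℂ] H, IsFiniteRankProjection P ∧
      ∀ k, hsNorm e (U k * P - P * U k) / hsNorm e P ≤ η := by
  classical
  set K := (Fintype.card κ : ℝ) with hK
  have hK0 : 0 ≤ K := Nat.cast_nonneg _
  obtain ⟨δ, hδ, hδη⟩ : ∃ δ : ℝ, 0 < δ ∧ K * (δ ^ 2 / 2 + δ) < η ^ 2 / 2 := by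
    have hc : Tendsto (fun δ : ℝ => K * (δ ^ 2 / 2 + δ)) (nhdsWithin 0 (Set.Ioi 0)) (nhds 0) := by
      have : Continuous fun δ : ℝ => K * (δ ^ 2 / 2 + δ) := by fun_prop
      simpa using (this.tendsto 0).mono_left nhdsWithin_le_nhds
    obtain ⟨δ, h1, h2⟩ := ((hc.eventually_lt_const (show 0 < η ^ 2 / 2 by positivity)).and
      self_mem_nhdsWithin).exists
    exact ⟨δ, h2, h1⟩
  obtain ⟨n, v, μ, hv, hμ, hμ1, happ⟩ :=
    exists_approximate_density hpos hone U hΨ hΨ' (show 0 < δ ^ 2 by positivity)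
  have hUv : ∀ k, Orthonormal ℂ fun j => U k (v j) := fun k => orthonormal_unitary_comp hv (hU k)
  let c : κ → Fin n → Fin n → ℝ := fun k i j => ‖⟪v i, U k (v j)⟫_ℂ‖ ^ 2
  have hcol : ∀ k j, ∑ i, c k i j ≤ 1 := fun k j => by
    have := hv.sum_inner_products_le (U k (v j)) (s := Finset.univ)
    rwa [(hUv k).norm_eq_one, one_pow] at this
  have hrow : ∀ k i, ∑ j, c k i j ≤ 1 := fun k i => by
    have := (hUv k).sum_inner_products_le (v i) (s := Finset.univ)
    rw [hv.norm_eq_one, one_pow] at this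
    simpa only [c, norm_inner_symm (v i)] using this
  have hmin : ∀ k, 1 - ∑ i, ∑ j, min (μ i) (μ j) * c k i j ≤ δ ^ 2 / 2 + δ := fun k =>
    one_sub_sum_min_le hμ hμ1 (fun i j => sq_nonneg _) (hrow k) (hcol k) hδ
      (two_sub_two_mul_overlap_le hv hμ hμ1 (hU k) (happ k) (sq_nonneg _))
  have hμle : ∀ i, μ i ≤ 1 := fun i =>
    hμ1 ▸ Finset.single_le_sum (fun j _ => hμ j) (Finset.mem_univ i)
  obtain ⟨t, ht⟩ := exists_sum_ite_lt_neg (R := Fin n ⊕ Fin n × Fin n)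
    (a := Sum.elim μ fun p => min (μ p.1) (μ p.2))
    (β := Sum.elim (fun _ => K - η ^ 2 / 2) fun p => -∑ k, c k p.1 p.2)
    (by rintro (i | p); exacts [hμ i, le_min (hμ _) (hμ _)])
    (by rintro (i | p); exacts [hμle i, (min_le_left _ _).trans (hμle _)])
    (by
      have h := Finset.sum_le_sum fun k (_ : k ∈ Finset.univ) => hmin k
      simp only [Finset.sum_sub_distrib, Finset.sum_const, Finset.card_univ, nsmul_eq_mul,
        mul_one] at h
      have h2 : ∑ p : Fin n × Fin n, (-∑ k, c k p.1 p.2) * min (μ p.1) (μ p.2) =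
          -∑ k, ∑ i, ∑ j, min (μ i) (μ j) * c k i j := by
        simp only [Fintype.sum_prod_type, neg_mul, Finset.sum_neg_distrib, Finset.sum_mul]
        rw [neg_inj, eq_comm, Finset.sum_comm]
        refine Finset.sum_congr rfl fun i _ => ?_
        rw [Finset.sum_comm]
        exact Finset.sum_congr rfl fun j _ => Finset.sum_congr rfl fun k _ => mul_comm _ _
      rw [Fintype.sum_sum_type]
      simp only [Sum.elim_inl, Sum.elim_inr]
      rw [h2, ← Finset.mul_sum, hμ1]
      linarith)
  let S : Type := {i // t < μ i}
  let w : S → H := fun i => v i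
  have hw : Orthonormal ℂ w := hv.comp _ Subtype.val_injective
  have hsum : ∀ f : Fin n → ℝ, ∑ i, f i * (if t < μ i then 1 else 0) = ∑ i : S, f i := by
    intro f
    simp only [mul_ite, mul_one, mul_zero]
    rw [← Finset.sum_filter]
    exact Finset.sum_subtype _ (by simp) _
  have hsum₂ : ∀ g : Fin n → Fin n → ℝ, ∑ p : Fin n × Fin n,
      g p.1 p.2 * (if t < min (μ p.1) (μ p.2) then 1 else 0) = ∑ i : S, ∑ j : S, g i j := by
    intro g
    rw [Fintype.sum_prod_type, ← hsum fun i => ∑ j : S, g i j]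
    refine Finset.sum_congr rfl fun i _ => ?_
    rw [← hsum (g i), Finset.sum_mul]
    refine Finset.sum_congr rfl fun j _ => ?_
    by_cases h1 : t < μ i <;> by_cases h2 : t < μ j <;> simp [h1, h2]
  have hlt : ∑ k, (Fintype.card S - ∑ i : S, ∑ j : S, c k i j) < η ^ 2 / 2 * Fintype.card S := by
    have h1 : ∑ i : S, ∑ j : S, -∑ k, c k i j = -∑ k, ∑ i : S, ∑ j : S, c k i j := by
      simp only [Finset.sum_neg_distrib]
      rw [neg_inj, eq_comm, Finset.sum_comm]
      exact Finset.sum_congr rfl fun i _ => Finset.sum_comm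
    have ht' : ∑ i, (K - η ^ 2 / 2) * (if t < μ i then 1 else 0) + ∑ p : Fin n × Fin n,
        (-∑ k, c k p.1 p.2) * (if t < min (μ p.1) (μ p.2) then 1 else 0) < 0 := by
      rw [Fintype.sum_sum_type] at ht
      exact ht
    rw [hsum₂ fun i j => -∑ k, c k i j, h1, hsum fun _ => K - η ^ 2 / 2, Finset.sum_const,
      Finset.card_univ, nsmul_eq_mul] at ht'
    rw [Finset.sum_sub_distrib, Finset.sum_const, Finset.card_univ, nsmul_eq_mul, ← hK]
    linarith
  have hcomm : ∀ k, hsNorm e (U k * frameProjection w - frameProjection w * U k) ^ 2 =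
      2 * (Fintype.card S - ∑ i : S, ∑ j : S, c k i j) := by
    intro k
    have hUw := orthonormal_unitary_comp hw (hU k)
    have hUw' := orthonormal_unitary_comp hw (Unitary.star_mem (hU k))
    rw [hsNorm_commutator_sq e hw, Finset.sum_comm]
    simp only [hUw.norm_eq_one, hUw'.norm_eq_one, one_pow, Finset.sum_const, Finset.card_univ,
      nsmul_eq_mul, mul_one]
    simp only [w, c]
    ring
  have hnonneg : ∀ k, 0 ≤ (Fintype.card S : ℝ) - ∑ i : S, ∑ j : S, c k i j := fun k => by
    linarith [sq_nonneg (hsNorm e (U k * frameProjection w - frameProjection w * U k)), hcomm k]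
  have hS : 0 < (Fintype.card S : ℝ) := by
    have := (Finset.sum_nonneg fun k _ => hnonneg k).trans_lt hlt
    exact pos_of_mul_pos_right this (by positivity)
  have : Nonempty S := Fintype.card_pos_iff.1 (by exact_mod_cast hS)
  refine ⟨frameProjection w, isFiniteRankProjection_frameProjection hw, fun k => ?_⟩
  have hk := (Finset.single_le_sum (fun k _ => hnonneg k) (Finset.mem_univ k)).trans_lt hlt
  refine div_le_of_le_mul₀ (hsNorm_nonneg _ _) hη.le (le_of_sq_le_sq ?_
    (mul_nonneg hη.le (hsNorm_nonneg _ _)))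
  rw [hcomm, mul_pow, hsNorm_frameProjection_sq e hw]
  linarith

theorem StarSubalgebra.mem_span_unitary {𝓐 : StarSubalgebra ℂ (H →L[ℂ] H)}
    (h𝓐 : IsClosed (𝓐 : Set (H →L[ℂ] H))) {A : H →L[ℂ] H} (hA : A ∈ 𝓐) :
    A ∈ Submodule.span ℂ {U | U ∈ 𝓐 ∧ U ∈ unitary (H →L[ℂ] H)} := by
  have : IsClosed (𝓐 : Set (H →L[ℂ] H)) := h𝓐
  have h : (⟨A, hA⟩ : 𝓐) ∈ Submodule.span ℂ (unitary 𝓐 : Set 𝓐) := by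
    rw [CStarAlgebra.span_unitary]
    trivial
  have h2 := Submodule.mem_map_of_mem (f := 𝓐.subtype.toAlgHom.toLinearMap) h
  rw [Submodule.map_span] at h2
  refine Submodule.span_mono ?_ h2
  rintro _ ⟨U, hU, rfl⟩
  have hU' := Unitary.mem_iff.1 hU
  exact ⟨U.2, Unitary.mem_iff.2
    ⟨congrArg Subtype.val hU'.1, congrArg Subtype.val hU'.2⟩⟩

end HypertraceToFolner

theorem stmt3 {H : Type u} [NormedAddCommGroup H] [InnerProductSpace ℂ H]
    [CompleteSpace H] [SecondCountableTopology H]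
    {ι : Type*} (e : HilbertBasis ι ℂ H)
    -- a concrete C*-algebra acting on `H`
    (𝓐 : StarSubalgebra ℂ (H →L[ℂ] H)) (h𝓐 : IsClosed (𝓐 : Set (H →L[ℂ] H))) :
    -- `𝓐` has a Følner net
    (∃ (I : Type u) (instI : Preorder I) (P : I → (H →L[ℂ] H)),
        IsDirected I (· ≤ ·) ∧ Nonempty I ∧
        (∀ i, IsFiniteRankProjection (P i)) ∧
        (∀ A ∈ 𝓐, Tendsto (fun i => hsNorm e (A * P i - P i * A) / hsNorm e (P i))
          (@atTop I instI) (nhds 0)))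
    ↔
    -- `𝓐` has a hypertrace: a state on `B(H)` centralised by `𝓐`
    (∃ Ψ : (H →L[ℂ] H) →ₗ[ℂ] ℂ,
        (∀ X : H →L[ℂ] H, 0 ≤ Ψ (star X * X)) ∧ Ψ 1 = 1 ∧
        (∀ X : H →L[ℂ] H, ∀ A ∈ 𝓐, Ψ (X * A) = Ψ (A * X))) := by
  classical
  constructor
  · rintro ⟨I, instI, P, hdir, hne, hP, h⟩
    exact exists_hypertrace_of_folner e (𝓐 : Set (H →L[ℂ] H)) atTop P hP h
  · rintro ⟨Ψ, hpos, hone, hΨ⟩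
    have hex : ∀ i : Finset (H →L[ℂ] H) × ℕ, ∃ P : H →L[ℂ] H, IsFiniteRankProjection P ∧
        ∀ U ∈ i.1, U ∈ 𝓐 → U ∈ unitary (H →L[ℂ] H) →
          hsNorm e (U * P - P * U) / hsNorm e P ≤ 1 / ((i.2 : ℝ) + 1) := by
      rintro ⟨F, m⟩
      obtain ⟨P, hP, h⟩ := exists_projection_almost_commuting e hpos hone
        (κ := {U // U ∈ F.filter fun U => U ∈ 𝓐 ∧ U ∈ unitary (H →L[ℂ] H)}) Subtype.val
        (fun U => (Finset.mem_filter.1 U.2).2.2)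
        (fun U X => hΨ X U (Finset.mem_filter.1 U.2).2.1)
        (fun U X => hΨ X _ (star_mem (Finset.mem_filter.1 U.2).2.1))
        (Nat.one_div_pos_of_nat (n := m))
      exact ⟨P, hP, fun U hF h1 h2 => h ⟨U, Finset.mem_filter.2 ⟨hF, h1, h2⟩⟩⟩
    choose P hP hPU using hex
    refine ⟨_, inferInstance, P, inferInstance, inferInstance, hP, fun A hA => ?_⟩
    refine (Submodule.span_le (p := folnerSubmodule e atTop P hP)).2 ?_
      (StarSubalgebra.mem_span_unitary h𝓐 hA)
    rintro U ⟨hU𝓐, hU⟩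
    have hlim : Tendsto (fun i : Finset (H →L[ℂ] H) × ℕ => 1 / ((i.2 : ℝ) + 1)) atTop (nhds 0) := by
      rw [← prod_atTop_atTop_eq]
      exact tendsto_one_div_add_atTop_nhds_zero_nat.comp tendsto_snd
    refine squeeze_zero' (.of_forall fun i => div_nonneg (hsNorm_nonneg _ _) (hsNorm_nonneg _ _))
      ?_ hlim
    filter_upwards [eventually_ge_atTop (({U}, 0) : Finset (H →L[ℂ] H) × ℕ)] with i hi
    exact hPU i U (hi.1 (Finset.mem_singleton_self U)) hU𝓐 hU
end

section
/- Let S₁ be the isometry on H = ℓ²(ℕ₀) defined by S₁ e_i = e_{2i} for the canonical orthonormal basis {e_i : i = 0, 1, 2, …}, and for each n ∈ ℕ₀ let P_n be the orthogonal projection onto span{e_0, e_1, …, e_n}. Then for every n ∈ ℕ one has ‖S₁ P_{2n} − P_{2n} S₁‖₂² / ‖P_{2n}‖₂² = n/(2n+1); in particular the quantity ‖S₁ P_n − P_n S₁‖₂ / ‖P_n‖₂ does not converge to 0, so {P_n} is not a Følner sequence for S₁. -/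
open Filter

/-- The Hilbert space `ℓ²(ℕ₀)`. -/
noncomputable abbrev ell2 : Type := lp (fun _ : ℕ => ℂ) 2

theorem HilbertBasis.tsum_ofReal_norm_inner_sq {H ι : Type*} [NormedAddCommGroup H]
    [InnerProductSpace ℂ H] (e : HilbertBasis ι ℂ H) (x : H) :
    ∑' i, ENNReal.ofReal (‖inner ℂ (e i) x‖ ^ 2) = ENNReal.ofReal (‖x‖ ^ 2) := by
  have h : HasSum (fun i => ‖inner ℂ (e i) x‖ ^ 2) (‖x‖ ^ 2) := by
    have h1 := Complex.hasSum_re (e.hasSum_inner_mul_inner x x)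
    have h2 (y : H) : (inner ℂ x y * inner ℂ y x).re = ‖inner ℂ y x‖ ^ 2 := by
      have h3 : (inner ℂ x y * inner ℂ y x).re = ‖inner ℂ x y * inner ℂ y x‖ :=
        inner_mul_symm_re_eq_norm (𝕜 := ℂ) x y
      rw [h3, norm_mul, norm_inner_symm, sq]
    have h3 : (inner ℂ x x).re = ‖x‖ ^ 2 := inner_self_eq_norm_sq (𝕜 := ℂ) x
    simpa only [h2, h3] using h1
  rw [← h.tsum_eq, ENNReal.ofReal_tsum_of_nonneg (fun _ => sq_nonneg _) h.summable]

/-- Tonelli exchange relating the Hilbert-Schmidt sums of an operator and of its adjoint. -/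
theorem HilbertBasis.tsum_ofReal_norm_sq_eq_adjoint {H ι κ : Type*} [NormedAddCommGroup H]
    [InnerProductSpace ℂ H] [CompleteSpace H] (f : HilbertBasis ι ℂ H) (e : HilbertBasis κ ℂ H)
    (A : H →L[ℂ] H) :
    ∑' i, ENNReal.ofReal (‖A (f i)‖ ^ 2)
      = ∑' j, ENNReal.ofReal (‖ContinuousLinearMap.adjoint A (e j)‖ ^ 2) := by
  calc ∑' i, ENNReal.ofReal (‖A (f i)‖ ^ 2)
      = ∑' i, ∑' j, ENNReal.ofReal (‖inner ℂ (e j) (A (f i))‖ ^ 2) := by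
        simp only [e.tsum_ofReal_norm_inner_sq]
    _ = ∑' j, ∑' i, ENNReal.ofReal (‖inner ℂ (e j) (A (f i))‖ ^ 2) := ENNReal.tsum_comm
    _ = ∑' j, ENNReal.ofReal (‖ContinuousLinearMap.adjoint A (e j)‖ ^ 2) := by
        refine tsum_congr fun j => ?_
        rw [← f.tsum_ofReal_norm_inner_sq]
        refine tsum_congr fun i => ?_
        rw [norm_inner_symm, ContinuousLinearMap.adjoint_inner_right]

theorem hsNorm_sq {H ι : Type*} [NormedAddCommGroup H] [InnerProductSpace ℂ H]
    (f : HilbertBasis ι ℂ H) (A : H →L[ℂ] H) : hsNorm f A ^ 2 = ∑' i, ‖A (f i)‖ ^ 2 :=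
  Real.sq_sqrt (tsum_nonneg fun _ => sq_nonneg _)

theorem hsNorm_eq_hsNorm {H ι κ : Type*} [NormedAddCommGroup H] [InnerProductSpace ℂ H]
    [CompleteSpace H] (f : HilbertBasis ι ℂ H) (e : HilbertBasis κ ℂ H) (A : H →L[ℂ] H) :
    hsNorm f A = hsNorm e A := by
  have h := congrArg ENNReal.toReal
    ((f.tsum_ofReal_norm_sq_eq_adjoint e A).trans (e.tsum_ofReal_norm_sq_eq_adjoint e A).symm)
  simp only [ENNReal.tsum_toReal_eq fun _ => ENNReal.ofReal_ne_top,
    ENNReal.toReal_ofReal (sq_nonneg _)] at h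
  rw [hsNorm, hsNorm, h]

/-- An operator mapping `e i` to a unit vector for `i ∈ s` and to `0` otherwise has squared
Hilbert-Schmidt norm `s.card`. -/
theorem hsNorm_sq_eq_card {H ι κ : Type*} [NormedAddCommGroup H] [InnerProductSpace ℂ H]
    [CompleteSpace H] (f : HilbertBasis ι ℂ H) (e : HilbertBasis κ ℂ H) (A : H →L[ℂ] H)
    (s : Finset κ) (h1 : ∀ i ∈ s, ‖A (e i)‖ = 1) (h0 : ∀ i ∉ s, A (e i) = 0) :
    hsNorm f A ^ 2 = s.card := by
  rw [hsNorm_eq_hsNorm f e, hsNorm_sq,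
    tsum_eq_sum (s := s) fun i hi => by simp [h0 i hi],
    Finset.sum_congr rfl fun i hi => by rw [h1 i hi, one_pow]]
  simp

theorem apply_eq_self_of_mem_range_of_mul_self {H : Type*} [NormedAddCommGroup H]
    [InnerProductSpace ℂ H] {P : H →L[ℂ] H} (hP : P * P = P) {x : H}
    (hx : x ∈ LinearMap.range (P : H →ₗ[ℂ] H)) : P x = x := by
  obtain ⟨y, rfl⟩ := hx
  exact congrArg (fun T : H →L[ℂ] H => T y) hP

/-- A self-adjoint operator with range in the span of `v` kills vectors orthogonal to `v`. -/
theorem IsSelfAdjoint.apply_eq_zero_of_range_le_span {H : Type*} [NormedAddCommGroup H]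
    [InnerProductSpace ℂ H] [CompleteSpace H] {P : H →L[ℂ] H} (hP : IsSelfAdjoint P)
    {v : Set H} (hv : LinearMap.range (P : H →ₗ[ℂ] H) ≤ Submodule.span ℂ v) {x : H}
    (hx : ∀ y ∈ v, inner ℂ y x = 0) : P x = 0 := by
  have hPx : P (P x) ∈ Submodule.span ℂ v := hv ⟨P x, rfl⟩
  have key : ∀ y ∈ Submodule.span ℂ v, inner ℂ y x = 0 := fun y hy =>
    Submodule.span_induction (p := fun y _ => inner ℂ y x = 0) hx (inner_zero_left _)
      (fun a b _ _ ha hb => by rw [inner_add_left, ha, hb, add_zero])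
      (fun c a _ ha => by rw [inner_smul_left, ha, mul_zero]) hy
  have h := key _ hPx
  rw [← ContinuousLinearMap.adjoint_inner_right, hP.adjoint_eq] at h
  exact inner_self_eq_zero.mp h

theorem stmt7
    -- the canonical orthonormal basis of `ℓ²(ℕ₀)`
    (e : HilbertBasis ℕ ℂ ell2) (he : ∀ i, (e i : ell2) = lp.single 2 i 1)
    -- an arbitrary orthonormal basis used to compute the Hilbert-Schmidt norm
    {ι : Type*} (f : HilbertBasis ι ℂ ell2)
    -- the isometry `S₁ e_i = e_{2i}` realizing part of the Cuntz algebra `𝒪₂`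
    (S₁ : ell2 →L[ℂ] ell2) (hS₁ : ∀ i, S₁ (e i) = e (2 * i))
    -- `P n` is the orthogonal projection onto `span {e 0, …, e n}`
    (P : ℕ → (ell2 →L[ℂ] ell2))
    (hPsa : ∀ n, IsSelfAdjoint (P n)) (hPidem : ∀ n, P n * P n = P n)
    (hPrange : ∀ n, LinearMap.range ((P n : ell2 →ₗ[ℂ] ell2))
      = Submodule.span ℂ {x : ell2 | ∃ i ≤ n, x = e i}) :
    (∀ n : ℕ, 1 ≤ n →
      hsNorm f (S₁ * P (2 * n) - P (2 * n) * S₁) ^ 2 / hsNorm f (P (2 * n)) ^ 2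
        = (n : ℝ) / (2 * n + 1)) ∧
    ¬ Tendsto (fun n => hsNorm f (S₁ * P n - P n * S₁) / hsNorm f (P n)) atTop (nhds 0) := by
  have he1 : ∀ i, ‖e i‖ = 1 := e.orthonormal.1
  have hP1 : ∀ m i, i ≤ m → P m (e i) = e i := fun m i hi =>
    apply_eq_self_of_mem_range_of_mul_self (hPidem m)
      (hPrange m ▸ Submodule.subset_span ⟨i, hi, rfl⟩)
  have hP0 : ∀ m i, m < i → P m (e i) = 0 := fun m i hi =>
    (hPsa m).apply_eq_zero_of_range_le_span (hPrange m).le (by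
      rintro _ ⟨j, hj, rfl⟩
      exact e.orthonormal.2 (by omega))
  have hP : ∀ m, hsNorm f (P m) ^ 2 = (m : ℝ) + 1 := fun m => by
    rw [hsNorm_sq_eq_card f e (P m) (Finset.range (m + 1))]
    · simp
    · intro i hi
      rw [hP1 m i (by simpa [Nat.lt_succ_iff] using hi), he1]
    · intro i hi
      exact hP0 m i (by simpa using hi)
  have hC : ∀ n, hsNorm f (S₁ * P (2 * n) - P (2 * n) * S₁) ^ 2 = (n : ℝ) := fun n => by
    rw [hsNorm_sq_eq_card f e _ (Finset.Ioc n (2 * n))]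
    · rw [Nat.card_Ioc]
      congr 1
      omega
    · intro i hi
      rw [Finset.mem_Ioc] at hi
      simp [hS₁, hP1 _ i hi.2, hP0 (2 * n) (2 * i) (by omega), he1]
    · intro i hi
      rw [Finset.mem_Ioc] at hi
      rcases le_or_gt i n with h | h
      · simp [hS₁, hP1 (2 * n) i (by omega), hP1 (2 * n) (2 * i) (by omega)]
      · simp [hS₁, hP0 (2 * n) i (by omega), hP0 (2 * n) (2 * i) (by omega)]
  have hratio : ∀ n : ℕ,
      hsNorm f (S₁ * P (2 * n) - P (2 * n) * S₁) ^ 2 / hsNorm f (P (2 * n)) ^ 2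
        = (n : ℝ) / (2 * n + 1) := fun n => by
    rw [hC, hP]
    push_cast
    rfl
  refine ⟨fun n _ => hratio n, fun h => ?_⟩
  have hsub := (h.comp (tendsto_id.const_mul_atTop' (two_pos : (0 : ℕ) < 2))).pow 2
  rw [zero_pow two_ne_zero] at hsub
  obtain ⟨n, hn, hn1⟩ := ((hsub.eventually_lt_const (show (0 : ℝ) < 1 / 3 by norm_num)).and
    (eventually_ge_atTop 1)).exists
  simp only [Function.comp_apply, id_eq, div_pow, hratio] at hn
  have hn1' : (1 : ℝ) ≤ n := by exact_mod_cast hn1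
  rw [div_lt_div_iff₀ (by positivity) (by norm_num)] at hn
  linarith
end

section
/- Let 𝕋 be the unit circle with normalized Haar measure, {ε_k(z) = z^k : k ∈ ℤ} the standard orthonormal basis of L²(𝕋), and for n ∈ ℕ₀ let Q_n be the orthogonal projection of L²(𝕋) onto span{ε_0, ε_1, …, ε_n}. Fix θ ∈ ℝ and define α_k(g)(z) = g(e^{2πikθ} z) for g ∈ L^∞(𝕋), k ∈ ℤ. Then for every g ∈ L^∞(𝕋): lim_{n→∞} ( max_{k ∈ {−n,…,n}} ‖[Q_n, M_{α_{−k}(g)}]‖₂ / ‖Q_n‖₂ ) = 0, where M_h is the multiplication operator by h on L²(𝕋). In particular the compatibility condition required for the crossed-product Følner theorem holds for the rotation action of ℤ on L^∞(𝕋) with the Følner sequence Γ_n = {−n, …, n} for ℤ. -/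
open Filter MeasureTheory AddCircle
open scoped ENNReal

instance : Fact ((0:ℝ) < 1) := ⟨one_pos⟩

/-- Normalised Haar measure on the circle `𝕋 = ℝ/ℤ`. -/
noncomputable abbrev μT : Measure (AddCircle (1:ℝ)) := haarAddCircle

section HilbertSchmidt

variable {H : Type*} [NormedAddCommGroup H] [InnerProductSpace ℂ H]

theorem HilbertBasis.tsum_enorm_inner_sq {ι : Type*} (b : HilbertBasis ι ℂ H) (x : H) :
    ∑' i, ‖inner ℂ (b i) x‖ₑ ^ 2 = ‖x‖ₑ ^ 2 := by
  have hs : HasSum (fun i => ‖inner ℂ (b i) x‖ ^ 2) (‖x‖ ^ 2) := by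
    have h := Complex.hasSum_re (b.hasSum_inner_mul_inner x x)
    have hx : (inner ℂ x x : ℂ).re = ‖x‖ ^ 2 := inner_self_eq_norm_sq (𝕜 := ℂ) x
    rw [hx] at h
    refine h.congr_fun fun i => ?_
    rw [← inner_conj_symm x (b i), mul_comm, Complex.mul_conj, Complex.ofReal_re,
      Complex.normSq_eq_norm_sq]
  have h := ENNReal.ofReal_tsum_of_nonneg (fun i => sq_nonneg ‖inner ℂ (b i) x‖) hs.summable
  rw [hs.tsum_eq] at h
  simpa only [ENNReal.ofReal_pow (norm_nonneg _), ofReal_norm] using h.symm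

theorem HilbertBasis.tsum_enorm_apply_sq_eq_adjoint [CompleteSpace H] {ι κ : Type*}
    (e : HilbertBasis ι ℂ H) (b : HilbertBasis κ ℂ H) (A : H →L[ℂ] H) :
    ∑' i, ‖A (e i)‖ₑ ^ 2 = ∑' j, ‖ContinuousLinearMap.adjoint A (b j)‖ₑ ^ 2 := by
  simp_rw [← b.tsum_enorm_inner_sq (A _), ← e.tsum_enorm_inner_sq (ContinuousLinearMap.adjoint A _)]
  rw [ENNReal.tsum_comm]
  refine tsum_congr fun j => tsum_congr fun i => ?_
  rw [← ContinuousLinearMap.adjoint_inner_left, ← inner_conj_symm, RCLike.enorm_conj]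

theorem HilbertBasis.tsum_enorm_apply_sq_eq [CompleteSpace H] {ι κ : Type*}
    (e : HilbertBasis ι ℂ H) (b : HilbertBasis κ ℂ H) (A : H →L[ℂ] H) :
    ∑' i, ‖A (e i)‖ₑ ^ 2 = ∑' j, ‖A (b j)‖ₑ ^ 2 :=
  (e.tsum_enorm_apply_sq_eq_adjoint b A).trans (b.tsum_enorm_apply_sq_eq_adjoint b A).symm

theorem hsNorm_eq_sqrt_toReal [CompleteSpace H] {ι κ : Type*}
    (e : HilbertBasis ι ℂ H) (b : HilbertBasis κ ℂ H) (A : H →L[ℂ] H) :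
    hsNorm e A = Real.sqrt (∑' j, ‖A (b j)‖ₑ ^ 2).toReal := by
  rw [hsNorm, ← e.tsum_enorm_apply_sq_eq b, ENNReal.tsum_toReal_eq (fun i => by finiteness)]
  simp

theorem hsNorm_eq_sqrt_toReal_matrix [CompleteSpace H] {ι κ : Type*}
    (e : HilbertBasis ι ℂ H) (b : HilbertBasis κ ℂ H) (A : H →L[ℂ] H) :
    hsNorm e A = Real.sqrt (∑' j, ∑' i, ‖inner ℂ (b i) (A (b j))‖ₑ ^ 2).toReal := by
  simp_rw [hsNorm_eq_sqrt_toReal e b, b.tsum_enorm_inner_sq]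

/-- A self-adjoint idempotent whose range is the closed span of part of a Hilbert basis
acts diagonally on that basis. -/
theorem HilbertBasis.projection_apply [CompleteSpace H] {κ : Type*} (b : HilbertBasis κ ℂ H)
    (s : Set κ) [DecidablePred (· ∈ s)] {P : H →L[ℂ] H} (hsa : IsSelfAdjoint P)
    (hidem : P * P = P)
    (hrange : LinearMap.range (P : H →ₗ[ℂ] H) = Submodule.span ℂ (b '' s)) (j : κ) :
    P (b j) = if j ∈ s then b j else 0 := by
  classical
  have hPP (x : H) : P (P x) = P x := DFunLike.congr_fun hidem x
  split_ifs with hj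
  · have hmem : b j ∈ LinearMap.range (P : H →ₗ[ℂ] H) :=
      hrange ▸ Submodule.subset_span ⟨j, hj, rfl⟩
    obtain ⟨x, hx⟩ := hmem
    rw [← hx]
    exact hPP x
  · have horth (y : H) (hy : y ∈ Submodule.span ℂ (b '' s)) : inner ℂ (b j) y = 0 := by
      induction hy using Submodule.span_induction with
      | mem x hx =>
        obtain ⟨i, hi, rfl⟩ := hx
        exact b.orthonormal.2 fun h => hj (h ▸ hi)
      | zero => exact inner_zero_right _
      | add x y _ _ hx hy => rw [inner_add_right, hx, hy, add_zero]
      | smul a x _ hx => rw [inner_smul_right, hx, mul_zero]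
    have hself : inner ℂ (P (b j)) (P (b j)) = (0 : ℂ) := by
      rw [← ContinuousLinearMap.adjoint_inner_right, hsa.adjoint_eq, hPP]
      exact horth _ (hrange ▸ LinearMap.mem_range_self (P : H →ₗ[ℂ] H) (b j))
    exact inner_self_eq_zero.mp hself

end HilbertSchmidt

/-- The integers `j` for which exactly one of `j` and `j + m` lies in `{0, …, n}`. -/
noncomputable def intervalBoundary (n : ℕ) (m : ℤ) : Finset ℤ :=
  symmDiff (Finset.Icc 0 (n : ℤ)) ((Finset.Icc 0 (n : ℤ)).map (Equiv.subRight m).toEmbedding)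

theorem mem_intervalBoundary {n : ℕ} {m j : ℤ} :
    j ∈ intervalBoundary n m ↔
      (j ∈ Finset.Icc 0 (n : ℤ) ∧ j + m ∉ Finset.Icc 0 (n : ℤ)) ∨
      (j + m ∈ Finset.Icc 0 (n : ℤ) ∧ j ∉ Finset.Icc 0 (n : ℤ)) := by
  have h : j ∈ (Finset.Icc 0 (n : ℤ)).map (Equiv.subRight m).toEmbedding ↔
      j + m ∈ Finset.Icc 0 (n : ℤ) := by
    rw [Finset.mem_map_equiv]
    simp
  rw [intervalBoundary, Finset.mem_symmDiff, h]

theorem card_intervalBoundary_le (n : ℕ) (m : ℤ) :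
    (intervalBoundary n m).card ≤ 2 * (n + 1) := by
  refine (Finset.card_le_card (Finset.symmDiff_subset_union)).trans
    ((Finset.card_union_le _ _).trans ?_)
  rw [Finset.card_map, Int.card_Icc]
  omega

theorem card_intervalBoundary_le_natAbs (n : ℕ) (m : ℤ) :
    (intervalBoundary n m).card ≤ 4 * m.natAbs := by
  have hsub : intervalBoundary n m ⊆
      Finset.Ico (-m.natAbs : ℤ) m.natAbs ∪ Finset.Ioc (n - m.natAbs : ℤ) (n + m.natAbs) := by
    intro j hj
    rw [mem_intervalBoundary] at hj
    simp only [Finset.mem_union, Finset.mem_Ico, Finset.mem_Ioc, Finset.mem_Icc] at hj ⊢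
    omega
  refine (Finset.card_le_card hsub).trans ((Finset.card_union_le _ _).trans ?_)
  rw [Int.card_Ico, Int.card_Ioc]
  omega

theorem tendsto_tsum_card_intervalBoundary {a : ℤ → ℝ} (ha : Summable a) (ha0 : ∀ m, 0 ≤ a m) :
    Tendsto (fun n : ℕ => ∑' m, (intervalBoundary n m).card / ((n : ℝ) + 1) * a m)
      atTop (nhds 0) := by
  have h := tendsto_tsum_of_dominated_convergence (𝓕 := atTop) (g := fun _ : ℤ => (0 : ℝ))
    (f := fun (n : ℕ) (m : ℤ) => (intervalBoundary n m).card / ((n : ℝ) + 1) * a m)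
    (ha.mul_left 2) (fun m => ?_) (Eventually.of_forall fun n m => ?_)
  · simpa using h
  · have hlim : Tendsto (fun n : ℕ => (4 * m.natAbs : ℝ) * (1 / ((n : ℝ) + 1)) * a m)
        atTop (nhds 0) := by
      simpa using (tendsto_one_div_add_atTop_nhds_zero_nat.const_mul
        (4 * m.natAbs : ℝ)).mul_const (a m)
    refine squeeze_zero (fun n => mul_nonneg (by positivity) (ha0 m)) (fun n => ?_) hlim
    rw [mul_one_div]
    gcongr
    · exact ha0 m
    · exact_mod_cast card_intervalBoundary_le_natAbs n m
  · rw [Real.norm_of_nonneg (mul_nonneg (by positivity) (ha0 m))]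
    gcongr
    · exact ha0 m
    · rw [div_le_iff₀ (by positivity)]
      exact_mod_cast card_intervalBoundary_le n m

theorem inner_fourierBasis_apply_of_mul {h : AddCircle (1 : ℝ) → ℂ} {A : Lp ℂ 2 μT →L[ℂ] Lp ℂ 2 μT}
    (hA : ∀ f : Lp ℂ 2 μT, (A f : AddCircle (1 : ℝ) → ℂ) =ᵐ[μT]
      fun x => h x * (f : AddCircle (1 : ℝ) → ℂ) x) (i j : ℤ) :
    inner ℂ ((fourierBasis (T := (1 : ℝ))) i) (A ((fourierBasis (T := (1 : ℝ))) j)) =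
      fourierCoeff h (i - j) := by
  rw [coe_fourierBasis, L2.inner_def, fourierCoeff]
  refine integral_congr_ae ?_
  filter_upwards [hA (fourierLp 2 j), coeFn_fourierLp (T := (1 : ℝ)) 2 i,
    coeFn_fourierLp (T := (1 : ℝ)) 2 j] with x hx hi hj
  rw [hx, hi, hj, RCLike.inner_apply, neg_sub, sub_eq_add_neg, fourier_add, fourier_neg, smul_eq_mul]
  ring

theorem fourierCoeff_comp_sub_right (h : AddCircle (1 : ℝ) → ℂ) (c : AddCircle (1 : ℝ)) (m : ℤ) :
    fourierCoeff (fun x => h (x - c)) m = fourier (-m) c * fourierCoeff h m := by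
  rw [fourierCoeff, fourierCoeff,
    ← integral_sub_right_eq_self (fun t => (fourier (-m)) t • h t) c, ← integral_const_mul]
  refine integral_congr_ae (Eventually.of_forall fun x => ?_)
  have hx : fourier (-m) x = fourier (-m) c * fourier (-m) (x - c) := by
    simp only [fourier_apply, ← Circle.coe_mul, ← toCircle_add, ← smul_add, add_sub_cancel]
  simp only [smul_eq_mul, hx, mul_assoc]

theorem norm_fourierCoeff_of_ae_eq_comp_sub_right {h h' : AddCircle (1 : ℝ) → ℂ}
    {c : AddCircle (1 : ℝ)} (hh : h' =ᵐ[μT] fun x => h (x - c)) (m : ℤ) :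
    ‖fourierCoeff h' m‖ = ‖fourierCoeff h m‖ := by
  have heq : fourierCoeff h' m = fourierCoeff (fun x => h (x - c)) m := by
    refine integral_congr_ae ?_
    filter_upwards [hh] with x hx
    rw [hx]
  rw [heq, fourierCoeff_comp_sub_right, norm_mul, fourier_apply, Circle.norm_coe, one_mul]

theorem summable_sq_norm_fourierCoeff_of_mul {h : AddCircle (1 : ℝ) → ℂ}
    {A : Lp ℂ 2 μT →L[ℂ] Lp ℂ 2 μT}
    (hA : ∀ f : Lp ℂ 2 μT, (A f : AddCircle (1 : ℝ) → ℂ) =ᵐ[μT]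
      fun x => h x * (f : AddCircle (1 : ℝ) → ℂ) x) :
    Summable fun m => ‖fourierCoeff h m‖ ^ 2 := by
  have hp := (fourierBasis (T := (1 : ℝ))).tsum_enorm_inner_sq
    (A ((fourierBasis (T := (1 : ℝ))) 0))
  simp_rw [inner_fourierBasis_apply_of_mul hA, sub_zero] at hp
  have hs := ENNReal.summable_toReal (hp ▸ by finiteness :
    ∑' m, ‖fourierCoeff h m‖ₑ ^ 2 ≠ ∞)
  simpa using hs

theorem hsNorm_commutator_of_mul {ι : Type*} (e : HilbertBasis ι ℂ (Lp ℂ 2 μT)) {n : ℕ}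
    {P : Lp ℂ 2 μT →L[ℂ] Lp ℂ 2 μT} (hsa : IsSelfAdjoint P)
    (hP : ∀ j : ℤ, P ((fourierBasis (T := (1 : ℝ))) j) =
      if j ∈ Finset.Icc 0 (n : ℤ) then (fourierBasis (T := (1 : ℝ))) j else 0)
    {h : AddCircle (1 : ℝ) → ℂ} {A : Lp ℂ 2 μT →L[ℂ] Lp ℂ 2 μT}
    (hA : ∀ f : Lp ℂ 2 μT, (A f : AddCircle (1 : ℝ) → ℂ) =ᵐ[μT]
      fun x => h x * (f : AddCircle (1 : ℝ) → ℂ) x) :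
    hsNorm e (P * A - A * P) =
      Real.sqrt (∑' m, (intervalBoundary n m).card * ‖fourierCoeff h m‖ ^ 2) := by
  rw [hsNorm_eq_sqrt_toReal_matrix e fourierBasis]
  have hentry (j m : ℤ) : ‖inner ℂ ((fourierBasis (T := (1 : ℝ))) (j + m))
      ((P * A - A * P) ((fourierBasis (T := (1 : ℝ))) j))‖ₑ ^ 2 =
      if j ∈ intervalBoundary n m then ‖fourierCoeff h m‖ₑ ^ 2 else 0 := by
    have hc := inner_fourierBasis_apply_of_mul hA (j + m) j
    rw [add_sub_cancel_left] at hc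
    rw [sub_apply, mul_apply_eq_comp, mul_apply_eq_comp, inner_sub_right,
      ← ContinuousLinearMap.adjoint_inner_left, hsa.adjoint_eq, hP, hP]
    simp only [mem_intervalBoundary]
    by_cases h1 : j ∈ Finset.Icc 0 (n : ℤ) <;> by_cases h2 : j + m ∈ Finset.Icc 0 (n : ℤ) <;>
      simp [h1, h2, hc, -Finset.mem_Icc, -coe_fourierBasis]
  have hsum (m : ℤ) : ∑' j, (if j ∈ intervalBoundary n m then ‖fourierCoeff h m‖ₑ ^ 2 else 0) =
      (intervalBoundary n m).card * ‖fourierCoeff h m‖ₑ ^ 2 := by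
    rw [tsum_eq_sum (s := intervalBoundary n m) fun j hj => if_neg hj, Finset.sum_ite_mem,
      Finset.inter_self, Finset.sum_const, nsmul_eq_mul]
  have hshift (j : ℤ) := (Equiv.addLeft j).tsum_eq fun i =>
    ‖inner ℂ ((fourierBasis (T := (1 : ℝ))) i)
      ((P * A - A * P) ((fourierBasis (T := (1 : ℝ))) j))‖ₑ ^ 2
  simp only [Equiv.coe_addLeft, hentry] at hshift
  simp_rw [← hshift]
  rw [ENNReal.tsum_comm]
  simp_rw [hsum]
  rw [ENNReal.tsum_toReal_eq fun m => by finiteness]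
  simp

theorem hsNorm_of_fourierBasis_diagonal {ι : Type*} (e : HilbertBasis ι ℂ (Lp ℂ 2 μT)) {n : ℕ}
    {P : Lp ℂ 2 μT →L[ℂ] Lp ℂ 2 μT}
    (hP : ∀ j : ℤ, P ((fourierBasis (T := (1 : ℝ))) j) =
      if j ∈ Finset.Icc 0 (n : ℤ) then (fourierBasis (T := (1 : ℝ))) j else 0) :
    hsNorm e P = Real.sqrt ((n : ℝ) + 1) := by
  have hterm (j : ℤ) : ‖P ((fourierBasis (T := (1 : ℝ))) j)‖ₑ ^ 2 =
      if j ∈ Finset.Icc 0 (n : ℤ) then 1 else 0 := by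
    have h1 : ‖(fourierBasis (T := (1 : ℝ))) j‖ₑ = 1 := by
      rw [← ofReal_norm, fourierBasis.orthonormal.1 j, ENNReal.ofReal_one]
    rw [hP]
    split_ifs <;> simp [h1, -coe_fourierBasis]
  rw [hsNorm_eq_sqrt_toReal e fourierBasis]
  simp_rw [hterm]
  rw [tsum_eq_sum (s := Finset.Icc 0 (n : ℤ)) fun j hj => if_neg hj, Finset.sum_ite_mem,
    Finset.inter_self, Finset.sum_const, Int.card_Icc]
  congr 1
  simp
  norm_cast

theorem stmt18 (θ : ℝ)
    -- an orthonormal basis of `L²(𝕋)` computing Hilbert-Schmidt norms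
    {ι : Type*} (e : HilbertBasis ι ℂ (Lp ℂ 2 μT))
    -- multiplication operators by `L^∞` functions
    (M : Lp ℂ ∞ μT → (Lp ℂ 2 μT →L[ℂ] Lp ℂ 2 μT))
    (hM : ∀ (h : Lp ℂ ∞ μT) (f : Lp ℂ 2 μT),
      (M h f : AddCircle (1:ℝ) → ℂ) =ᵐ[μT]
        fun x => (h : AddCircle (1:ℝ) → ℂ) x * (f : AddCircle (1:ℝ) → ℂ) x)
    -- `Q n` is the orthogonal projection onto `span {ε_0, …, ε_n}`, `ε_k (z) = z^k`
    (Q : ℕ → (Lp ℂ 2 μT →L[ℂ] Lp ℂ 2 μT))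
    (hQsa : ∀ n, IsSelfAdjoint (Q n)) (hQidem : ∀ n, Q n * Q n = Q n)
    (hQrange : ∀ n, LinearMap.range ((Q n : Lp ℂ 2 μT →ₗ[ℂ] Lp ℂ 2 μT))
      = Submodule.span ℂ {h : Lp ℂ 2 μT | ∃ k : ℕ, k ≤ n ∧ h = fourierLp 2 (k : ℤ)})
    -- `g ∈ L^∞(𝕋)` and its rotations `gk k = α_{-k}(g) = g(· − kθ)`
    (g : Lp ℂ ∞ μT) (gk : ℤ → Lp ℂ ∞ μT)
    (hgk : ∀ k : ℤ, ((gk k : AddCircle (1:ℝ) → ℂ)) =ᵐ[μT]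
      fun x => (g : AddCircle (1:ℝ) → ℂ) (x - (((k:ℝ) * θ : ℝ) : AddCircle (1:ℝ)))) :
    -- the compatibility condition for the Følner sequence `Γ_n = {-n, …, n}` of `ℤ`
    Tendsto (fun n : ℕ =>
      ((Finset.Icc (-(n:ℤ)) (n:ℤ)).sup' ⟨0, by simp only [Finset.mem_Icc]; omega⟩
        fun k => hsNorm e (Q n * M (gk k) - M (gk k) * Q n)) / hsNorm e (Q n))
      atTop (nhds 0) := by
  have hQ (n : ℕ) (j : ℤ) : Q n ((fourierBasis (T := (1 : ℝ))) j) =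
      if j ∈ Finset.Icc 0 (n : ℤ) then (fourierBasis (T := (1 : ℝ))) j else 0 := by
    have hset : {h : Lp ℂ 2 μT | ∃ k : ℕ, k ≤ n ∧ h = fourierLp 2 (k : ℤ)} =
        (fourierBasis (T := (1 : ℝ))) '' (Finset.Icc 0 (n : ℤ) : Set ℤ) := by
      ext f
      simp only [coe_fourierBasis, Set.mem_ofPred_eq, Set.mem_image, Finset.mem_coe, Finset.mem_Icc]
      constructor
      · rintro ⟨k, hk, rfl⟩
        exact ⟨k, by omega, rfl⟩
      · rintro ⟨k, hk, rfl⟩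
        lift k to ℕ using hk.1
        exact ⟨k, by omega, rfl⟩
    exact fourierBasis.projection_apply (Finset.Icc 0 (n : ℤ) : Set ℤ) (hQsa n) (hQidem n)
      ((hQrange n).trans (congrArg _ hset)) j
  have hlim := (tendsto_tsum_card_intervalBoundary
    (summable_sq_norm_fourierCoeff_of_mul (hM g)) fun m => sq_nonneg _).sqrt
  rw [Real.sqrt_zero] at hlim
  refine hlim.congr fun n => ?_
  have hcomm (k : ℤ) : hsNorm e (Q n * M (gk k) - M (gk k) * Q n) =
      Real.sqrt (∑' m, (intervalBoundary n m).card *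
        ‖fourierCoeff (g : AddCircle (1 : ℝ) → ℂ) m‖ ^ 2) := by
    rw [hsNorm_commutator_of_mul e (hQsa n) (hQ n) (hM (gk k))]
    simp_rw [norm_fourierCoeff_of_ae_eq_comp_sub_right (hgk k)]
  have hsup (hne : (Finset.Icc (-(n : ℤ)) n).Nonempty) :=
    (Finset.sup'_congr hne rfl fun k _ => hcomm k).trans (Finset.sup'_const hne _)
  refine ((congrArg (· / hsNorm e (Q n)) (hsup _)).trans ?_).symm
  rw [hsNorm_of_fourierBasis_diagonal e (hQ n), ← Real.sqrt_div' _ (by positivity),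
    ← tsum_div_const]
  simp_rw [div_mul_eq_mul_div]
end
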